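/- There exist constants c > 0 and γ > 0 depending only on d and k, and q₀ ∈ (0,1), such that for all 0 < q < q₀, with ℓ = ℓ(q) defined by ℓ = c q^{−1/(d−1)} if k = 2 and ℓ = exp_{(k−2)}(c q^{−1/(d−k+1)}) if k ≥ 3, the μ-probability of the event B is at most e^{−γℓ}. -/

import Mathlib

open MeasureTheory ENNReal

noncomputable section

namespace KA

open scoped Classical

/-- Sites of the lattice `ℤ^d`. -/
abbrev Site (d : ℕ) := Fin d → ℤ

/-- A configuration: `true` = occupied, `false` = empty. -/
abbrev Config (d : ℕ) := Site d → Bool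

variable {d : ℕ}

def origin : Site d := fun _ => 0

def eVec (d : ℕ) (i : Fin d) : Site d := fun j => if j = i then 1 else 0

/-- Nearest neighbours in `ℤ^d`. -/
def adj (x y : Site d) : Prop := (∑ i, |x i - y i|) = 1

/-- The set of (at most `2d`) nearest neighbours of a site. -/
def neighbors (x : Site d) : Finset (Site d) :=
  Finset.image (fun p : Fin d × Bool =>
    Function.update x p.1 (x p.1 + if p.2 then 1 else -1)) Finset.univ

/-- The Kob-Andersen kinetic constraint `c_{xy}` for parameter `k`:
`x` has at least `k-1` empty neighbours other than `y`, and vice versa. -/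
def constraint (k : ℕ) (η : Config d) (x y : Site d) : Prop :=
  k - 1 ≤ ((neighbors x).filter fun z => z ≠ y ∧ η z = false).card ∧
  k - 1 ≤ ((neighbors y).filter fun z => z ≠ x ∧ η z = false).card

/-- `c_{xy}(η)` as a `{0,1}`-valued quantity. -/
def cval (k : ℕ) (η : Config d) (x y : Site d) : ℝ≥0∞ :=
  if constraint k η x y then 1 else 0

/-- `η^{xy}` : the configuration with the values at `x` and `y` exchanged. -/
def swap (η : Config d) (x y : Site d) : Config d :=
  fun z => if z = x then η y else if z = y then η x else η z

/-- `(τ_y η)(z) = η (z - y)`. -/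
def shift (y : Site d) (η : Config d) : Config d := fun z => η (z - y)

/-- A local function depends on finitely many coordinates. -/
def IsLocal (f : Config d → ℝ) : Prop :=
  ∃ S : Finset (Site d), ∀ η η' : Config d, (∀ x ∈ S, η x = η' x) → f η = f η'

def dotZ (u : Fin d → ℝ) (y : Site d) : ℝ := ∑ i, u i * (y i : ℝ)

/-- The environment part `Σ_{x ≠ 0} Σ_{y ∼ x} c_{xy} (f(η^{xy}) - f(η))²`. -/
def envTerm (k : ℕ) (f : Config d → ℝ) (η : Config d) : ℝ≥0∞ :=
  ∑' p : Site d × Site d,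
    if p.1 ≠ origin ∧ adj p.1 p.2 then
      cval k η p.1 p.2 * ENNReal.ofReal ((f (swap η p.1 p.2) - f η) ^ 2)
    else 0

/-- The tagged-particle part `Σ_{y ∼ 0} c_{0y} (u·y + f(τ_y η^{0y}) - f(η))²`. -/
def tagTerm (k : ℕ) (u : Fin d → ℝ) (f : Config d → ℝ) (η : Config d) : ℝ≥0∞ :=
  ∑' y : Site d,
    if adj origin y then
      cval k η origin y *
        ENNReal.ofReal ((dotZ u y + f (shift y (swap η origin y)) - f η) ^ 2)
    else 0

/-- The variational (Dirichlet) functional `E_u(f)` integrated against `μ₀`. -/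
def energy (k : ℕ) (u : Fin d → ℝ) (μ0 : Measure (Config d)) (f : Config d → ℝ) : ℝ≥0∞ :=
  ∫⁻ η, envTerm k f η + tagTerm k u f η ∂μ0

/-- `μ` is the Bernoulli product measure where each site is independently
occupied with probability `1 - q`. -/
def IsBernoulliProduct (q : ℝ) (μ : Measure (Config d)) : Prop :=
  IsProbabilityMeasure μ ∧
  ∀ (S : Finset (Site d)) (ζ : Site d → Bool),
    μ {η | ∀ x ∈ S, η x = ζ x} = ∏ x ∈ S, ENNReal.ofReal (if ζ x then 1 - q else q)

/-- `μ₀ = μ(· | η(0) = 1)`. -/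
def condOcc (μ : Measure (Config d)) : Measure (Config d) :=
  ProbabilityTheory.cond μ {η | η origin = true}

/-- The first standard basis vector of `ℝ^d`. -/
def e1R (d : ℕ) : Fin d → ℝ := fun i => if (i : ℕ) = 0 then 1 else 0

def basisR (d : ℕ) (i : Fin d) : Fin d → ℝ := fun j => if j = i then 1 else 0

/-- The quadratic form `u ↦ inf over local f of E_u(f)`. -/
def Qform (k : ℕ) (μ : Measure (Config d)) (u : Fin d → ℝ) : ℝ≥0∞ :=
  ⨅ f : {f : Config d → ℝ // IsLocal f}, energy k u (condOcc μ) f.1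

/-- The self-diffusion coefficient `D(q) = inf_f E_{e₁}(f)`. -/
def diffCoeff (k : ℕ) (μ : Measure (Config d)) : ℝ≥0∞ := Qform k μ (e1R d)

/-- `expIter n` is the `n`-fold iterated exponential. -/
def expIter : ℕ → ℝ → ℝ
  | 0, x => x
  | n + 1, x => Real.exp (expIter n x)

/-! ### Frameability, goodness, block-connectedness -/

/-- Fill every site outside `V` with a particle. -/
def fillOutside (V : Set (Site d)) (η : Config d) : Config d :=
  fun z => if z ∈ V then η z else true

/-- A single legal KA-`k`f transition inside `V`. -/
def KAStep (k : ℕ) (V : Set (Site d)) (η η' : Config d) : Prop :=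
  ∃ x y, adj x y ∧ x ∈ V ∧ y ∈ V ∧ η x ≠ η y ∧ constraint k η x y ∧ η' = swap η x y

/-- A generalized box with minimal corner `a`, spanning the directions in `E`,
with side length `m` (coordinates outside `E` are frozen at `a`). -/
def genBox (a : Site d) (E : Finset (Fin d)) (m : ℕ) : Set (Site d) :=
  {x | ∀ i, (i ∈ E → a i ≤ x i ∧ x i < a i + m) ∧ (i ∉ E → x i = a i)}

/-- The `k'`-th frame of the generalized box: the union of all of its
`(k'-1)`-dimensional slices passing through the minimal corner. -/
def genFrame (k' : ℕ) (a : Site d) (E : Finset (Fin d)) (m : ℕ) : Set (Site d) :=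
  {x | x ∈ genBox a E m ∧ (E.filter fun i => x i ≠ a i).card ≤ k' - 1}

/-- The generalized box is frameable for `η` : `η` (with the outside filled by
particles) is connected by legal KA-`k'`f transitions inside the box to a
configuration whose `k'`-th frame is empty. -/
def Frameable (k' : ℕ) (a : Site d) (E : Finset (Fin d)) (m : ℕ) (η : Config d) : Prop :=
  ∃ η', Relation.ReflTransGen (KAStep k' (genBox a E m)) (fillOutside (genBox a E m) η) η' ∧
    ∀ x ∈ genFrame k' a E m, η' x = false

def one (d : ℕ) : Site d := fun _ => 1

/-- minimal corner of the box `b + [m]^d`. -/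
def corner (b : Site d) : Site d := fun i => b i + 1

/-- All codimension-one slices of the generalized box are `(k'-1)`-frameable,
for every configuration differing from `η` in at most one site. -/
def SlicesOK (k' : ℕ) (a : Site d) (E : Finset (Fin d)) (m : ℕ) (η : Config d) : Prop :=
  ∀ η' : Config d, {x | η' x ≠ η x}.Subsingleton →
    ∀ i ∈ E, ∀ t : ℕ, t < m →
      Frameable (k' - 1) (Function.update a i (a i + t)) (E.erase i) m η'

/-- A good box: all codimension-one slices frameable (robustly to one spin flip),
with one extra empty site in addition to the ones required. -/
def GoodBox (k' : ℕ) (a : Site d) (E : Finset (Fin d)) (m : ℕ) (η : Config d) : Prop :=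
  SlicesOK k' a E m η ∧
  ∃ x₀ ∈ genBox a E m, η x₀ = false ∧ SlicesOK k' a E m (Function.update η x₀ true)

/-- The length scale `ℓ = ℓ(q)`. -/
def lscale (d k : ℕ) (c q : ℝ) : ℕ :=
  if k = 2 then ⌈c * Real.log (1 / q) * q ^ (-(1 : ℝ) / ((d : ℝ) - 1))⌉₊
  else ⌈c * expIter (k - 2) (q ^ (-(1 : ℝ) / ((d : ℝ) - (k : ℝ) + 1)))⌉₊

/-- The length scale `L = q^{-cℓ}`. -/
def Lscale (q c : ℝ) (ℓ : ℕ) : ℕ := ⌈q ^ (-(c * (ℓ : ℝ)))⌉₊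

/-- One step between adjacent boxes: the base point moves by `±ℓ e_i`. -/
def pathStep (ℓ : ℕ) (b b' : Site d) : Prop :=
  ∃ i : Fin d, ∃ s : Bool,
    b' = fun j => b j + if j = i then (if s then (ℓ : ℤ) else -(ℓ : ℤ)) else 0

/-- A `(d,k)`-super-good path of boxes of side `ℓ` inside the block `v + [L]^d`,
joining `v + [ℓ]^d` to `v + (L-ℓ)e_α + [ℓ]^d`, of length at most `3L`:
all boxes good and at least one frameable. -/
def SuperGoodPath (k ℓ L : ℕ) (v : Site d) (α : Fin d) (η : Config d) : Prop :=
  ∃ n : ℕ, n ≤ 3 * L ∧ ∃ b : ℕ → Site d,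
    b 0 = v ∧
    (b n = fun j => v j + if j = α then (L : ℤ) - (ℓ : ℤ) else 0) ∧
    (∀ m < n, pathStep ℓ (b m) (b (m + 1))) ∧
    (∀ m ≤ n, genBox (corner (b m)) Finset.univ ℓ ⊆ genBox (corner v) Finset.univ L) ∧
    (∀ m ≤ n, GoodBox k (corner (b m)) Finset.univ ℓ η) ∧
    (∃ m ≤ n, Frameable k (corner (b m)) Finset.univ ℓ η)

/-- minimal corner of the external face of the box `genBox a univ m` in
direction `j`, on the positive (`s = true`) or negative side. -/
def faceBase (a : Site d) (m : ℕ) (j : Fin d) (s : Bool) : Site d :=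
  Function.update a j (if s then a j + m else a j - 1)

/-- The face `F` is adjacent to the vertex `v`. -/
def FaceNear (v : Site d) (F : Set (Site d)) : Prop := ∃ x ∈ F, ∀ i, |x i - v i| ≤ 1

/-- All `(d-1)`-dimensional external faces of the box `genBox a univ m` that are
adjacent to the vertex `v` are `(d-1, k-1)`-good. -/
def GoodFacesAt (k : ℕ) (a : Site d) (m : ℕ) (v : Site d) (η : Config d) : Prop :=
  ∀ (j : Fin d) (s : Bool),
    FaceNear v (genBox (faceBase a m j s) (Finset.univ.erase j) m) →
    GoodBox (k - 1) (faceBase a m j s) (Finset.univ.erase j) m η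

/-- The coarse vertices `v` and `v + (L+1)e_α` are `(d,k)`-block-connected. -/
def BlockConnected (k ℓ L : ℕ) (v : Site d) (α : Fin d) (η : Config d) : Prop :=
  SuperGoodPath k ℓ L v α η ∧
  GoodFacesAt k (corner v) ℓ v η ∧
  GoodFacesAt k (corner (fun j => v j + if j = α then (L : ℤ) - (ℓ : ℤ) else 0)) (ℓ + 1)
    (fun j => v j + if j = α then (L : ℤ) + 1 else 0) η

/-! ### `T`-step moves -/

/-- A `T`-step move with domain determined by the set of configurations `M`,
whose transitions are legal KA-`k`f transitions contained in `V`,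
keeping track of the position of a marked particle. -/
structure TStepMove (d k : ℕ) (M : Set (Config d)) (V : Set (Site d)) (T : ℕ) where
  conf : Config d → ℕ → Config d
  pos : Config d → Site d → ℕ → Site d
  conf_zero : ∀ η ∈ M, conf η 0 = η
  pos_zero : ∀ η ∈ M, ∀ z : Site d, η z = true → pos η z 0 = z
  step : ∀ η ∈ M, ∀ z : Site d, η z = true → ∀ t < T,
    (conf η (t + 1) = conf η t ∧ pos η z (t + 1) = pos η z t) ∨
    ∃ x y, adj x y ∧ x ∈ V ∧ y ∈ V ∧ conf η t x = true ∧ conf η t y = false ∧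
      constraint k (conf η t) x y ∧ conf η (t + 1) = swap (conf η t) x y ∧
      pos η z (t + 1) = if pos η z t = x then y else pos η z t

/-- `Loss(M) ≤ K` : at every step, at most `2^K` configurations of the domain
have a common image. -/
def LossBoundedBy {d k : ℕ} {M : Set (Config d)} {V : Set (Site d)} {T : ℕ}
    (mv : TStepMove d k M V T) (K : ℝ) : Prop :=
  ∀ t < T, ∀ η' ∈ M, ∃ S : Finset (Config d),
    {η ∈ M | mv.conf η t = mv.conf η' t ∧ mv.conf η (t + 1) = mv.conf η' (t + 1)} ⊆ ↑S ∧
    (S.card : ℝ) ≤ (2 : ℝ) ^ K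

/-! ### Bond configurations on the coarse lattice -/

/-- A bond configuration on the coarse lattice: the edge `(i, α)` joins the
coarse vertices of index `i` and `i + e_α`. -/
abbrev BondConfig (d : ℕ) := (Site d × Fin d) → Bool

def IsLocalBond (g : BondConfig d → ℝ) : Prop :=
  ∃ S : Finset (Site d × Fin d), ∀ ω ω' : BondConfig d, (∀ e ∈ S, ω e = ω' e) → g ω = g ω'

/-- Translation of a bond configuration by a coarse index vector. -/
def bondShift (v : Site d) (ω : BondConfig d) : BondConfig d := fun e => (ω (e.1 - v, e.2))

/-- Two coarse indices joined by an open bond. -/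
def bondRel (ω : BondConfig d) (i j : Site d) : Prop :=
  (∃ α, j = i + eVec d α ∧ ω (i, α) = true) ∨ (∃ α, i = j + eVec d α ∧ ω (j, α) = true)

/-- The event `{0 ↔ ∞}`: the origin lies in an infinite open cluster. -/
def InfiniteCluster : Set (BondConfig d) :=
  {ω | {j : Site d | Relation.ReflTransGen (bondRel ω) origin j}.Infinite}

/-- The coarse index of the neighbour `± e_α` of the coarse origin. -/
def coarseIdx (d : ℕ) (α : Fin d) (s : Bool) : Site d :=
  if s then eVec d α else -(eVec d α)

/-- The actual lattice vector `±(L+1) e_α` of a coarse neighbour of the origin. -/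
def coarseVecZ (d L : ℕ) (α : Fin d) (s : Bool) : Site d :=
  fun j => ((L : ℤ) + 1) * coarseIdx d α s j

/-- Indicator of the bond between the coarse origin and its neighbour `± e_α`. -/
def edgeInd (ω : BondConfig d) (α : Fin d) (s : Bool) : ℝ≥0∞ :=
  if (if s then ω (origin, α) else ω (-(eVec d α), α)) = true then 1 else 0

/-- The auxiliary quadratic form `u ↦ u ⬝ D_aux u`. -/
def QauxForm (d L : ℕ) (μstar : Measure (BondConfig d)) (u : Fin d → ℝ) : ℝ≥0∞ :=
  ⨅ g : {g : BondConfig d → ℝ // IsLocalBond g},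
    ∑ α : Fin d, ∑ s : Bool,
      ∫⁻ ω, edgeInd ω α s *
        ENNReal.ofReal (((if s then (1 : ℝ) else -1) * ((L : ℝ) + 1) * u α +
          g.1 (bondShift (coarseIdx d α s) ω) - g.1 ω) ^ 2) ∂μstar

/-- Indicator (on microscopic configurations) that the coarse origin and its
neighbour `± e_α` are block-connected, for an abstract notion `BC`. -/
def microEdgeInd (BC : Site d → Fin d → Config d → Bool) (α : Fin d) (s : Bool)
    (η : Config d) : ℝ≥0∞ :=
  if (if s then BC origin α η else BC (-(eVec d α)) α η) = true then 1 else 0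

/-- The microscopic comparison form
`u ↦ inf_f Σ_{i ∼ 0} μ₀[ η̄_{0i} (u·i + f(τ_i η^{0,i}) - f(η))² ]`. -/
def microForm (d k L : ℕ) (BC : Site d → Fin d → Config d → Bool)
    (μ0 : Measure (Config d)) (u : Fin d → ℝ) : ℝ≥0∞ :=
  ⨅ f : {f : Config d → ℝ // IsLocal f},
    ∑ α : Fin d, ∑ s : Bool,
      ∫⁻ η, microEdgeInd BC α s η *
        ENNReal.ofReal (((if s then (1 : ℝ) else -1) * ((L : ℝ) + 1) * u α +
          f.1 (shift (coarseVecZ d L α s) (swap η origin (coarseVecZ d L α s))) - f.1 η) ^ 2)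
        ∂μ0

/-! ### d = 2 geometry -/

/-- The column `y + {c} × [ℓ]` in `ℤ²`. -/
def col2 (y : Site 2) (c : ℤ) (ℓ : ℕ) : Set (Site 2) :=
  {x | x 0 = y 0 + c ∧ y 1 + 1 ≤ x 1 ∧ x 1 ≤ y 1 + ℓ}

/-- The box `b + [ℓ]²`. -/
def box2 (b : Site 2) (ℓ : ℕ) : Set (Site 2) := genBox (corner b) Finset.univ ℓ

/-- `S` contains at least two empty sites. -/
def TwoEmptyIn (S : Set (Site 2)) (η : Config 2) : Prop :=
  ∃ a ∈ S, ∃ b ∈ S, a ≠ b ∧ η a = false ∧ η b = false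

/-- Every row and every column of the box `b + [ℓ]²` contains at least two
empty sites. -/
def RowsColsOK (b : Site 2) (ℓ : ℕ) (η : Config 2) : Prop :=
  (∀ t : ℕ, 1 ≤ t → t ≤ ℓ → TwoEmptyIn {z | z ∈ box2 b ℓ ∧ z 1 = b 1 + t} η) ∧
  (∀ t : ℕ, 1 ≤ t → t ≤ ℓ → TwoEmptyIn {z | z ∈ box2 b ℓ ∧ z 0 = b 0 + t} η)

/-- The box `b + [ℓ]²` is `(2,2)`-good: two empty sites in every row and
column, plus one additional empty site. -/
def Good22 (b : Site 2) (ℓ : ℕ) (η : Config 2) : Prop :=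
  RowsColsOK b ℓ η ∧
  ∃ w ∈ box2 b ℓ, η w = false ∧ RowsColsOK b ℓ (Function.update η w true)

/-! ### Bootstrap percolation -/

/-- The box `[-ℓ, ℓ]^d`. -/
def bigBox (d ℓ : ℕ) : Set (Site d) := {x | ∀ i, |x i| ≤ (ℓ : ℤ)}

/-- One step of `k`-neighbour bootstrap percolation on `[-ℓ,ℓ]^d` (sites
outside the box are left unchanged). -/
def BPstep (k ℓ : ℕ) (η : Config d) : Config d := fun x =>
  if x ∈ bigBox d ℓ then
    (if η x = true ∧
        ((neighbors x).filter fun z => z ∈ bigBox d ℓ ∧ η z = false).card < k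
      then true else false)
  else η x

/-- The limiting configuration of bootstrap percolation. -/
def BPinf (k ℓ : ℕ) (η : Config d) : Config d := fun x =>
  if ∀ t : ℕ, (BPstep k ℓ)^[t] η x = true then true else false

/-- One step along the bootstrap percolation cluster. -/
def bpRel (k ℓ : ℕ) (η : Config d) (a b : Site d) : Prop :=
  adj a b ∧ b ∈ bigBox d ℓ ∧ BPinf k ℓ η b = false

/-- The bootstrap percolation cluster of the origin. -/
def bpCluster (k ℓ : ℕ) (η : Config d) : Set (Site d) :=
  {x | Relation.ReflTransGen (bpRel k ℓ η) origin x}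

def coord0 (x : Site d) : ℤ := if h : 0 < d then x ⟨0, h⟩ else 0

/-- The first coordinate of the rightmost site of the bootstrap percolation
cluster of the origin. -/
def bpRightmost (k ℓ : ℕ) (η : Config d) : ℝ :=
  sSup ((fun x : Site d => (coord0 x : ℝ)) '' bpCluster k ℓ η)

/-- The test function `f`, computed on the restriction to `[-ℓ,ℓ]^d`. -/
def fTest (d k ℓ : ℕ) (η : Config d) : ℝ :=
  bpRightmost k ℓ (fillOutside (bigBox d ℓ) η)

/-- The event `B` : the bootstrap percolation cluster of the origin contains a
site of `ℓ^∞`-norm at least `ℓ - 1`. -/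
def Bevent (k ℓ : ℕ) (η : Config d) : Prop :=
  ∃ x ∈ bpCluster k ℓ η, ∃ i, (ℓ : ℤ) - 1 ≤ |x i|


/-! ### Finite Bernoulli expectations -/

section Prob

variable {α : Type*} [DecidableEq α]

/-- Expectation of `f` under Bernoulli(`q`) subsets of `U`. -/
def EE (q : ℝ) (U : Finset α) (f : Finset α → ℝ) : ℝ :=
  ∑ A ∈ U.powerset, q ^ A.card * (1 - q) ^ (U \ A).card * f A

/-- Real indicator. -/
def ind (p : Prop) : ℝ := if p then 1 else 0

lemma ind_nonneg (p : Prop) : 0 ≤ ind p := by unfold ind; split_ifs <;> norm_num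

lemma ind_le_one (p : Prop) : ind p ≤ 1 := by unfold ind; split_ifs <;> norm_num

lemma ind_true {p : Prop} (h : p) : ind p = 1 := by simp [ind, h]

lemma ind_false {p : Prop} (h : ¬ p) : ind p = 0 := by simp [ind, h]

lemma ind_mono {p r : Prop} (h : p → r) : ind p ≤ ind r := by
  by_cases hp : p
  · rw [ind_true hp, ind_true (h hp)]
  · rw [ind_false hp]; exact ind_nonneg _

lemma EE_empty (q : ℝ) (f : Finset α → ℝ) : EE q ∅ f = f ∅ := by simp [EE]

lemma EE_insert (q : ℝ) {a : α} {U : Finset α} (ha : a ∉ U) (f : Finset α → ℝ) :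
    EE q (insert a U) f = q * EE q U (fun A => f (insert a A)) + (1 - q) * EE q U f := by
  unfold EE
  rw [Finset.sum_powerset_insert ha, add_comm, Finset.mul_sum, Finset.mul_sum]
  congr 1
  · apply Finset.sum_congr rfl
    intro A hA
    have hA' := Finset.mem_powerset.1 hA
    have haA : a ∉ A := fun h => ha (hA' h)
    have : insert a U \ insert a A = U \ A := by
      ext x; simp only [Finset.mem_sdiff, Finset.mem_insert]
      constructor
      · rintro ⟨h1 | h1, h2⟩
        · exact absurd (Or.inl h1) h2
        · exact ⟨h1, fun h => h2 (Or.inr h)⟩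
      · rintro ⟨h1, h2⟩
        refine ⟨Or.inr h1, ?_⟩
        rintro (h | h)
        · exact ha (h ▸ h1)
        · exact h2 h
    rw [this, Finset.card_insert_of_notMem haA]
    ring
  · apply Finset.sum_congr rfl
    intro A hA
    have hA' := Finset.mem_powerset.1 hA
    have haA : a ∉ A := fun h => ha (hA' h)
    have : insert a U \ A = insert a (U \ A) := Finset.insert_sdiff_of_notMem _ haA
    rw [this, Finset.card_insert_of_notMem (by simp [ha])]
    ring

lemma EE_congr (q : ℝ) {U : Finset α} {f g : Finset α → ℝ} (h : ∀ A ⊆ U, f A = g A) :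
    EE q U f = EE q U g := by
  unfold EE
  apply Finset.sum_congr rfl
  intro A hA
  rw [h A (Finset.mem_powerset.1 hA)]

lemma EE_mono {q : ℝ} (h0 : 0 ≤ q) (h1 : q ≤ 1) {U : Finset α} {f g : Finset α → ℝ}
    (h : ∀ A ⊆ U, f A ≤ g A) : EE q U f ≤ EE q U g := by
  unfold EE
  apply Finset.sum_le_sum
  intro A hA
  have : 0 ≤ 1 - q := by linarith
  exact mul_le_mul_of_nonneg_left (h A (Finset.mem_powerset.1 hA)) (by positivity)

lemma EE_add (q : ℝ) (U : Finset α) (f g : Finset α → ℝ) :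
    EE q U (fun A => f A + g A) = EE q U f + EE q U g := by
  unfold EE
  rw [← Finset.sum_add_distrib]
  apply Finset.sum_congr rfl
  intro A _; ring

lemma EE_mul_const (q : ℝ) (U : Finset α) (f : Finset α → ℝ) (c : ℝ) :
    EE q U (fun A => f A * c) = EE q U f * c := by
  unfold EE
  rw [Finset.sum_mul]
  apply Finset.sum_congr rfl
  intro A _; ring

lemma EE_const_mul (q : ℝ) (U : Finset α) (f : Finset α → ℝ) (c : ℝ) :
    EE q U (fun A => c * f A) = c * EE q U f := by
  unfold EE
  rw [Finset.mul_sum]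
  apply Finset.sum_congr rfl
  intro A _; ring

lemma EE_sum (q : ℝ) (U : Finset α) {ι : Type*} (s : Finset ι) (f : ι → Finset α → ℝ) :
    EE q U (fun A => ∑ i ∈ s, f i A) = ∑ i ∈ s, EE q U (f i) := by
  unfold EE
  rw [Finset.sum_comm]
  apply Finset.sum_congr rfl
  intro A _; rw [Finset.mul_sum]

lemma EE_const (q : ℝ) (U : Finset α) (c : ℝ) : EE q U (fun _ => c) = c := by
  induction U using Finset.induction_on with
  | empty => exact EE_empty _ _
  | insert a U ha ih => rw [EE_insert q ha, ih]; ring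

lemma EE_nonneg {q : ℝ} (h0 : 0 ≤ q) (h1 : q ≤ 1) {U : Finset α} {f : Finset α → ℝ}
    (h : ∀ A ⊆ U, 0 ≤ f A) : 0 ≤ EE q U f := by
  have := EE_mono h0 h1 (f := fun _ => 0) h
  rwa [EE_const] at this

lemma EE_split (q : ℝ) (U W : Finset α) (hd : Disjoint U W) (f : Finset α → ℝ) :
    EE q (U ∪ W) f = EE q U (fun A => EE q W (fun B => f (A ∪ B))) := by
  induction U using Finset.induction_on generalizing f with
  | empty => simp [EE_empty]
  | insert a U ha ih =>
    rw [Finset.disjoint_insert_left] at hd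
    rw [Finset.insert_union, EE_insert q (by simp [ha, hd.1]), EE_insert q ha, ih hd.2, ih hd.2]
    simp only [Finset.insert_union]

lemma EE_restrict (q : ℝ) {S U : Finset α} (h : S ⊆ U) (f : Finset α → ℝ)
    (hf : ∀ A, f A = f (A ∩ S)) : EE q U f = EE q S f := by
  have hU : U = S ∪ (U \ S) := (Finset.union_sdiff_of_subset h).symm
  rw [hU, EE_split q _ _ Finset.disjoint_sdiff]
  apply EE_congr
  intro A hA
  rw [EE_congr q (g := fun _ => f A), EE_const]
  intro B hB
  rw [hf (A ∪ B), hf A]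
  congr 1
  ext x
  simp only [Finset.mem_inter, Finset.mem_union]
  constructor
  · rintro ⟨h1 | h1, h2⟩
    · exact ⟨h1, h2⟩
    · exact absurd h2 (Finset.mem_sdiff.1 (hB h1)).2
  · rintro ⟨h1, h2⟩; exact ⟨Or.inl h1, h2⟩

lemma EE_mem (q : ℝ) {z : α} {V : Finset α} (hz : z ∈ V) (g : Finset α → ℝ)
    (hg : ∀ A, g (insert z A) = g A) :
    EE q V (fun A => ind (z ∈ A) * g A) = q * EE q V g := by
  rw [← Finset.insert_erase hz, EE_insert q (Finset.notMem_erase z V),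
    EE_insert q (Finset.notMem_erase z V)]
  simp only [hg]
  rw [EE_congr q (f := fun A => ind (z ∈ insert z A) * g A) (g := g),
    EE_congr q (f := fun A => ind (z ∈ A) * g A) (g := fun _ => 0), EE_const]
  · ring
  · intro A hA
    rw [ind_false, zero_mul]
    intro h
    exact Finset.notMem_erase z V (hA h)
  · intro A _
    rw [ind_true (Finset.mem_insert_self _ _), one_mul]

/-- The Harris inequality: a decreasing and an increasing function are negatively correlated. -/
lemma EE_harris {q : ℝ} (h0 : 0 ≤ q) (h1 : q ≤ 1) (U : Finset α) (f g : Finset α → ℝ)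
    (hf : ∀ A B, A ⊆ B → B ⊆ U → f B ≤ f A) (hg : ∀ A B, A ⊆ B → B ⊆ U → g A ≤ g B) :
    EE q U (fun A => f A * g A) ≤ EE q U f * EE q U g := by
  induction U using Finset.induction_on generalizing f g with
  | empty => simp [EE_empty]
  | insert a U ha ih =>
    rw [EE_insert q ha, EE_insert q ha, EE_insert q ha]
    have i1 := ih (fun A => f (insert a A)) (fun A => g (insert a A))
      (fun A B hAB hB => hf _ _ (Finset.insert_subset_insert a hAB) (Finset.insert_subset_insert a hB))
      (fun A B hAB hB => hg _ _ (Finset.insert_subset_insert a hAB) (Finset.insert_subset_insert a hB))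
    have i2 := ih f g
      (fun A B hAB hB => hf _ _ hAB (hB.trans (Finset.subset_insert _ _)))
      (fun A B hAB hB => hg _ _ hAB (hB.trans (Finset.subset_insert _ _)))
    have m1 : EE q U (fun A => f (insert a A)) ≤ EE q U f :=
      EE_mono h0 h1 (fun A hA => hf _ _ (Finset.subset_insert _ _) (Finset.insert_subset_insert a hA))
    have m2 : EE q U g ≤ EE q U (fun A => g (insert a A)) :=
      EE_mono h0 h1 (fun A hA => hg _ _ (Finset.subset_insert _ _) (Finset.insert_subset_insert a hA))
    have h2 : 0 ≤ 1 - q := by linarith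
    have j1 := mul_le_mul_of_nonneg_left i1 h0
    have j2 := mul_le_mul_of_nonneg_left i2 h2
    have j3 := mul_nonneg (mul_nonneg h0 h2) (mul_nonneg (sub_nonneg.2 m1) (sub_nonneg.2 m2))
    nlinarith

/-- All of the fibres `a, a+1, …, a+n-1` are hit. -/
lemma EE_fibres {q : ℝ} (h0 : 0 ≤ q) (h1 : q ≤ 1) (V : Finset α) (φ : α → ℤ) (L : ℝ)
    (hL : ∀ j, ((V.filter fun z => φ z = j).card : ℝ) ≤ L) (a : ℤ) (n : ℕ) :
    EE q V (fun A => ind (∀ j : ℕ, j < n → ∃ z ∈ A, φ z = a + j)) ≤ (q * L) ^ n := by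
  have hL0 : 0 ≤ L := le_trans (Nat.cast_nonneg _) (hL 0)
  induction n with
  | zero =>
    simp only [pow_zero]
    calc _ ≤ EE q V (fun _ => 1) := EE_mono h0 h1 (fun A _ => ind_le_one _)
      _ = 1 := EE_const _ _ _
  | succ n ih =>
    calc _ ≤ EE q V (fun A => ∑ z ∈ V.filter (fun z => φ z = a + n), ind (z ∈ A) *
            ind (∀ j : ℕ, j < n → ∃ z ∈ A, φ z = a + j)) := by
          apply EE_mono h0 h1
          intro A hA
          have hnn : ∀ z ∈ V.filter (fun z => φ z = a + n), 0 ≤ ind (z ∈ A) *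
            ind (∀ j : ℕ, j < n → ∃ z ∈ A, φ z = a + j) :=
            fun z _ => mul_nonneg (ind_nonneg _) (ind_nonneg _)
          by_cases h : ∀ j : ℕ, j < n + 1 → ∃ z ∈ A, φ z = a + j
          · obtain ⟨z, hz, hzφ⟩ := h n (Nat.lt_succ_self n)
            refine le_trans ?_ (Finset.single_le_sum hnn
              (Finset.mem_filter.2 ⟨hA hz, hzφ⟩))
            rw [ind_true h, ind_true hz, ind_true (fun j hj => h j (Nat.lt_succ_of_lt hj))]
            norm_num
          · rw [ind_false h]; exact Finset.sum_nonneg hnn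
      _ = ∑ z ∈ V.filter (fun z => φ z = a + n),
            q * EE q V (fun A => ind (∀ j : ℕ, j < n → ∃ z ∈ A, φ z = a + j)) := by
          rw [EE_sum]
          apply Finset.sum_congr rfl
          intro z hz
          obtain ⟨hzV, hzφ⟩ := Finset.mem_filter.1 hz
          apply EE_mem q hzV
          intro A
          congr 1
          apply propext
          apply forall_congr'
          intro j
          apply imp_congr_right
          intro hj
          constructor
          · rintro ⟨y, hy, hyφ⟩
            rcases Finset.mem_insert.1 hy with rfl | hy
            · exfalso
              rw [hzφ] at hyφ
              omega
            · exact ⟨y, hy, hyφ⟩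
          · rintro ⟨y, hy, hyφ⟩
            exact ⟨y, Finset.mem_insert_of_mem hy, hyφ⟩
      _ ≤ (q * L) ^ (n + 1) := by
          rw [Finset.sum_const, nsmul_eq_mul]
          calc _ ≤ L * (q * (q * L) ^ n) := by
                apply mul_le_mul (hL _) (mul_le_mul_of_nonneg_left ih h0) _ hL0
                exact mul_nonneg h0 (EE_nonneg h0 h1 (fun A _ => ind_nonneg _))
            _ = _ := by ring

end Prob

/-! ### Closures and clusters -/

section Closure

/-- `X` is stable under `k`-neighbour infection in `U` and contains the seeds. -/
def Stab (k : ℕ) (U A X : Finset (Site d)) : Prop :=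
  A ∩ U ⊆ X ∧ ∀ z ∈ U, k ≤ (neighbors z ∩ X).card → z ∈ X

/-- The infected set in the region `U` started from `A`. -/
def cl (k : ℕ) (U A : Finset (Site d)) : Finset (Site d) :=
  U.filter fun x => ∀ X, Stab k U A X → x ∈ X

lemma cl_subset (k : ℕ) (U A : Finset (Site d)) : cl k U A ⊆ U := Finset.filter_subset _ _

lemma cl_min {k : ℕ} {U A X : Finset (Site d)} (h : Stab k U A X) : cl k U A ⊆ X := by
  intro x hx
  exact (Finset.mem_filter.1 hx).2 X h

lemma cl_stab (k : ℕ) (U A : Finset (Site d)) : Stab k U A (cl k U A) := by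
  constructor
  · intro x hx
    exact Finset.mem_filter.2 ⟨(Finset.mem_inter.1 hx).2, fun X hX => hX.1 hx⟩
  · intro z hz hk
    refine Finset.mem_filter.2 ⟨hz, fun X hX => hX.2 z hz (hk.trans (Finset.card_le_card ?_))⟩
    exact Finset.inter_subset_inter_left (cl_min hX)

lemma cl_mono {k : ℕ} {U U' A A' : Finset (Site d)} (hU : U ⊆ U') (hA : A ∩ U ⊆ A') :
    cl k U A ⊆ cl k U' A' := by
  apply cl_min
  constructor
  · intro x hx
    exact (cl_stab k U' A').1 (Finset.mem_inter.2 ⟨hA hx, hU (Finset.mem_inter.1 hx).2⟩)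
  · intro z hz hk
    exact (cl_stab k U' A').2 z (hU hz) hk

lemma cl_inter (k : ℕ) (U A : Finset (Site d)) : cl k U A = cl k U (A ∩ U) :=
  Finset.Subset.antisymm (cl_mono subset_rfl subset_rfl)
    (cl_mono subset_rfl (Finset.inter_subset_left.trans Finset.inter_subset_left))

/-- Connection inside `X`. -/
def conn (X : Finset (Site d)) (a b : Site d) : Prop :=
  a ∈ X ∧ Relation.ReflTransGen (fun u v => v ∈ neighbors u ∧ v ∈ X) a b

lemma conn.mem_left {X : Finset (Site d)} {a b : Site d} (h : conn X a b) : a ∈ X := h.1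

lemma conn.mem_right {X : Finset (Site d)} {a b : Site d} (h : conn X a b) : b ∈ X := by
  obtain ⟨h1, h2⟩ := h
  induction h2 with
  | refl => exact h1
  | tail _ h _ => exact h.2

lemma conn.refl {X : Finset (Site d)} {a : Site d} (h : a ∈ X) : conn X a a :=
  ⟨h, Relation.ReflTransGen.refl⟩

lemma conn.trans {X : Finset (Site d)} {a b c : Site d} (h : conn X a b) (h' : conn X b c) :
    conn X a c := ⟨h.1, h.2.trans h'.2⟩

lemma conn.step {X : Finset (Site d)} {a b c : Site d} (h : conn X a b) (h' : c ∈ neighbors b)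
    (hc : c ∈ X) : conn X a c := ⟨h.1, h.2.tail ⟨h', hc⟩⟩

lemma mem_neighbors {u v : Site d} : v ∈ neighbors u ↔
    ∃ i : Fin d, ∃ s : Bool, v = Function.update u i (u i + if s then 1 else -1) := by
  unfold neighbors
  simp only [Finset.mem_image, Finset.mem_univ, true_and, Prod.exists]
  constructor
  · rintro ⟨i, s, h⟩; exact ⟨i, s, h.symm⟩
  · rintro ⟨i, s, h⟩; exact ⟨i, s, h.symm⟩

lemma neighbors_symm {u v : Site d} (h : v ∈ neighbors u) : u ∈ neighbors v := by
  obtain ⟨i, s, rfl⟩ := mem_neighbors.1 h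
  refine mem_neighbors.2 ⟨i, !s, ?_⟩
  cases s <;> simp

lemma neighbors_dist {u v : Site d} (h : v ∈ neighbors u) (j : Fin d) : |v j - u j| ≤ 1 := by
  obtain ⟨i, s, rfl⟩ := mem_neighbors.1 h
  by_cases hj : j = i
  · subst hj; cases s <;> simp
  · simp [Function.update_of_ne hj]

lemma conn.symm {X : Finset (Site d)} {a b : Site d} (h : conn X a b) : conn X b a := by
  have hb := h.mem_right
  obtain ⟨h1, h2⟩ := h
  induction h2 with
  | refl => exact conn.refl h1
  | tail h h' ih =>
    have hm : _ ∈ X := conn.mem_right ⟨h1, h⟩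
    exact ((conn.refl h'.2).step (neighbors_symm h'.1) hm).trans (ih hm)

lemma conn.mono {X Y : Finset (Site d)} (hXY : X ⊆ Y) {a b : Site d} (h : conn X a b) :
    conn Y a b :=
  ⟨hXY h.1, Relation.ReflTransGen.mono (fun _ _ h => ⟨h.1, hXY h.2⟩) _ _ h.2⟩

/-- The component of `a` in `X`. -/
def comp (X : Finset (Site d)) (a : Site d) : Finset (Site d) := X.filter (conn X a)

lemma mem_comp {X : Finset (Site d)} {a b : Site d} : b ∈ comp X a ↔ conn X a b := by
  unfold comp
  rw [Finset.mem_filter]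
  exact ⟨fun h => h.2, fun h => ⟨h.mem_right, h⟩⟩

lemma comp_subset (X : Finset (Site d)) (a : Site d) : comp X a ⊆ X := Finset.filter_subset _ _

lemma comp_mono {X Y : Finset (Site d)} (h : X ⊆ Y) (a : Site d) : comp X a ⊆ comp Y a :=
  fun _ hb => mem_comp.2 ((mem_comp.1 hb).mono h)

/-- Paths inside a component stay inside the component. -/
lemma conn_comp {X : Finset (Site d)} {a b : Site d} (h : conn X a b) :
    conn (comp X a) a b := by
  obtain ⟨h1, h2⟩ := h
  induction h2 with
  | refl => exact conn.refl (mem_comp.2 (conn.refl h1))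
  | tail h hstep ih => exact ih.step hstep.1 (mem_comp.2 ⟨h1, h.tail hstep⟩)

/-- If the component of `a` in `X` is contained in `Y`, it is contained in the component in `Y`. -/
lemma comp_subset_comp {X Y : Finset (Site d)} {a : Site d} (h : comp X a ⊆ Y) :
    comp X a ⊆ comp Y a :=
  fun _ hb => mem_comp.2 ((conn_comp (mem_comp.1 hb)).mono h)

/-- The cluster of `x` for the `k`-neighbour process in `U`. -/
def C (k : ℕ) (U A : Finset (Site d)) (x : Site d) : Finset (Site d) := comp (cl k U A) x

lemma C_subset (k : ℕ) (U A : Finset (Site d)) (x : Site d) : C k U A x ⊆ U :=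
  (comp_subset _ _).trans (cl_subset _ _ _)

lemma C_mono {k : ℕ} {U U' A A' : Finset (Site d)} (hU : U ⊆ U') (hA : A ∩ U ⊆ A') (x : Site d) :
    C k U A x ⊆ C k U' A' x := comp_mono (cl_mono hU hA) x

lemma C_inter (k : ℕ) (U A : Finset (Site d)) (x : Site d) : C k U A x = C k U (A ∩ U) x := by
  unfold C; rw [← cl_inter]

lemma mem_C_self {k : ℕ} {U A : Finset (Site d)} {x y : Site d} (h : y ∈ C k U A x) :
    x ∈ C k U A x := mem_comp.2 (conn.refl (mem_comp.1 h).mem_left)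

/-- Clusters are internally spanned. -/
lemma C_internal {k : ℕ} {U A : Finset (Site d)} {x : Site d} :
    C k U A x ⊆ cl k (C k U A x) (A ∩ C k U A x) := by
  set C0 := C k U A x with hC0
  set Z := cl k C0 (A ∩ C0) with hZ
  have hst : Stab k U A (Z ∪ (cl k U A \ C0)) := by
    constructor
    · intro y hy
      have hy' := (cl_stab k U A).1 hy
      by_cases hyC : y ∈ C0
      · exact Finset.mem_union_left _ ((cl_stab k C0 (A ∩ C0)).1 (by
          simp only [Finset.mem_inter] at hy ⊢; exact ⟨⟨hy.1, hyC⟩, hyC⟩))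
      · exact Finset.mem_union_right _ (Finset.mem_sdiff.2 ⟨hy', hyC⟩)
    · intro z hz hk
      have hZC : Z ⊆ cl k U A := (cl_subset _ _ _).trans (comp_subset _ _)
      have hsub : Z ∪ (cl k U A \ C0) ⊆ cl k U A :=
        Finset.union_subset hZC Finset.sdiff_subset
      have hzcl : z ∈ cl k U A := (cl_stab k U A).2 z hz
        (hk.trans (Finset.card_le_card (Finset.inter_subset_inter_left hsub)))
      by_cases hzC : z ∈ C0
      · refine Finset.mem_union_left _ ((cl_stab k C0 (A ∩ C0)).2 z hzC
          (hk.trans (Finset.card_le_card ?_)))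
        intro y hy
        obtain ⟨hyn, hy⟩ := Finset.mem_inter.1 hy
        refine Finset.mem_inter.2 ⟨hyn, ?_⟩
        rcases Finset.mem_union.1 hy with hy | hy
        · exact hy
        · exfalso
          obtain ⟨hy1, hy2⟩ := Finset.mem_sdiff.1 hy
          exact hy2 (mem_comp.2 ((mem_comp.1 hzC).step hyn hy1))
      · exact Finset.mem_union_right _ (Finset.mem_sdiff.2 ⟨hzcl, hzC⟩)
  intro y hy
  rcases Finset.mem_union.1 (cl_min hst (comp_subset _ _ hy)) with h | h
  · exact h
  · exact absurd hy (Finset.mem_sdiff.1 h).2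

/-- A cluster contained in a region is infected in the region. -/
lemma C_subset_cl {k : ℕ} {U W A A' : Finset (Site d)} {x : Site d} (h : C k U A x ⊆ W)
    (hA : A ∩ C k U A x ⊆ A') : C k U A x ⊆ cl k W A' :=
  C_internal.trans (cl_mono h (Finset.inter_subset_left.trans hA))

/-- Given the seeds in the cluster, the event that the cluster equals `A0` is decreasing in
the outside seeds. -/
lemma C_key {k : ℕ} {U A0 F B B' : Finset (Site d)} {x : Site d} (hC : C k U (F ∪ B) x = A0)
    (hBB : B' ⊆ B) (hB : Disjoint B A0) : C k U (F ∪ B') x = A0 := by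
  apply Finset.Subset.antisymm
  · rw [← hC]
    exact C_mono subset_rfl
      (Finset.inter_subset_left.trans (Finset.union_subset_union_right hBB)) x
  · have h1 : C k U (F ∪ B) x ⊆ cl k U (F ∪ B') := by
      apply C_subset_cl (C_subset _ _ _ _)
      rw [hC]
      intro y hy
      obtain ⟨h1, h2⟩ := Finset.mem_inter.1 hy
      rcases Finset.mem_union.1 h1 with h | h
      · exact Finset.mem_union_left _ h
      · exact absurd h2 (Finset.disjoint_left.1 hB h)
    have := comp_subset_comp h1
    rw [← hC]
    exact this

end Closure

/-! ### Slabs and the chain estimate -/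

section Slabs

/-- `φ` is a slab index: each site has at most one neighbour `σ u` in another slab. -/
def SlabFn (φ : Site d → ℤ) (σ : Site d → Site d) : Prop :=
  (∀ u v, v ∈ neighbors u → φ u ≠ φ v → v = σ u) ∧ ∀ u, φ (σ u) ≤ φ u + 1

/-- The slab of index `j` in `U`. -/
def sl (φ : Site d → ℤ) (U : Finset (Site d)) (j : ℤ) : Finset (Site d) :=
  U.filter fun z => φ z = j

lemma mem_sl {φ : Site d → ℤ} {U : Finset (Site d)} {j : ℤ} {z : Site d} :
    z ∈ sl φ U j ↔ z ∈ U ∧ φ z = j := Finset.mem_filter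

lemma sl_subset (φ : Site d → ℤ) (U : Finset (Site d)) (j : ℤ) : sl φ U j ⊆ U :=
  Finset.filter_subset _ _

/-- The union of the slab processes. -/
def YY (k : ℕ) (φ : Site d → ℤ) (U A : Finset (Site d)) : Finset (Site d) :=
  U.filter fun z => z ∈ cl k (sl φ U (φ z)) A

lemma mem_YY {k : ℕ} {φ : Site d → ℤ} {U A : Finset (Site d)} {z : Site d} :
    z ∈ YY k φ U A ↔ z ∈ cl k (sl φ U (φ z)) A := by
  unfold YY
  rw [Finset.mem_filter]
  exact ⟨fun h => h.2, fun h => ⟨sl_subset _ _ _ (cl_subset _ _ _ h), h⟩⟩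

lemma cl_subset_YY {k : ℕ} {φ : Site d → ℤ} {σ : Site d → Site d} (hφ : SlabFn φ σ)
    (U A : Finset (Site d)) : cl (k + 1) U A ⊆ YY k φ U A := by
  apply cl_min
  constructor
  · intro x hx
    obtain ⟨h1, h2⟩ := Finset.mem_inter.1 hx
    exact mem_YY.2 ((cl_stab _ _ _).1 (Finset.mem_inter.2 ⟨h1, mem_sl.2 ⟨h2, rfl⟩⟩))
  · intro z hz hk
    refine mem_YY.2 ((cl_stab _ _ _).2 z (mem_sl.2 ⟨hz, rfl⟩) ?_)
    have hsub : neighbors z ∩ YY k φ U A ⊆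
        insert (σ z) (neighbors z ∩ cl k (sl φ U (φ z)) A) := by
      intro y hy
      obtain ⟨h1, h2⟩ := Finset.mem_inter.1 hy
      by_cases h : φ z = φ y
      · apply Finset.mem_insert_of_mem
        rw [mem_YY, ← h] at h2
        exact Finset.mem_inter.2 ⟨h1, h2⟩
      · rw [hφ.1 z y h1 h]
        exact Finset.mem_insert_self _ _
    have := (hk.trans (Finset.card_le_card hsub)).trans (Finset.card_insert_le _ _)
    omega

/-- The event that `x` is connected to slab index at least `M`. -/
def TT (k : ℕ) (φ : Site d → ℤ) (M : ℤ) (U A : Finset (Site d)) (x : Site d) : Prop :=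
  ∃ t, conn (YY k φ U A) x t ∧ M ≤ φ t

lemma YY_mono {k : ℕ} {φ : Site d → ℤ} {U A A' : Finset (Site d)} (h : A ∩ U ⊆ A') :
    YY k φ U A ⊆ YY k φ U A' := by
  intro z hz
  rw [mem_YY] at hz ⊢
  exact cl_mono subset_rfl
    ((Finset.inter_subset_inter_left (sl_subset _ _ _)).trans h) hz

lemma TT_mono {k : ℕ} {φ : Site d → ℤ} {M : ℤ} {U A A' : Finset (Site d)} (h : A ∩ U ⊆ A')
    {x : Site d} : TT k φ M U A x → TT k φ M U A' x := by
  rintro ⟨t, h1, h2⟩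
  exact ⟨t, h1.mono (YY_mono h), h2⟩

lemma TT_inter {k : ℕ} {φ : Site d → ℤ} {M : ℤ} {U A : Finset (Site d)}
    {x : Site d} : TT k φ M U A x ↔ TT k φ M U (A ∩ U) x :=
  ⟨TT_mono subset_rfl, TT_mono (Finset.inter_subset_left.trans Finset.inter_subset_left)⟩

lemma YY_sdiff {k : ℕ} {φ : Site d → ℤ} {U A : Finset (Site d)} {x z : Site d}
    (hz : z ∈ YY k φ U A) (hzC : z ∉ C k (sl φ U (φ x)) A x) :
    z ∈ YY k φ (U \ C k (sl φ U (φ x)) A x) A := by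
  rw [mem_YY] at hz ⊢
  have hzz : z ∈ C k (sl φ U (φ z)) A z := mem_comp.2 (conn.refl hz)
  refine C_subset_cl (U := sl φ U (φ z)) (x := z) ?_ Finset.inter_subset_left hzz
  intro y hy
  obtain ⟨hyU, hyφ⟩ := mem_sl.1 (C_subset _ _ _ _ hy)
  refine mem_sl.2 ⟨Finset.mem_sdiff.2 ⟨hyU, ?_⟩, hyφ⟩
  intro hyC
  have hyx := (mem_sl.1 (C_subset _ _ _ _ hyC)).2
  have hzx : φ z = φ x := by rw [← hyφ, hyx]
  rw [hzx] at hy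
  exact hzC (mem_comp.2 ((mem_comp.1 hyC).trans (mem_comp.1 hy).symm))

lemma TT_decomp {k : ℕ} {φ : Site d → ℤ} {σ : Site d → Site d} (hφ : SlabFn φ σ) {M : ℤ}
    {U A : Finset (Site d)} {x : Site d} (hM : φ x < M) (h : TT k φ M U A x) :
    ∃ z ∈ C k (sl φ U (φ x)) A x, TT k φ M (U \ C k (sl φ U (φ x)) A x) A (σ z) := by
  obtain ⟨t, ⟨hx, hp⟩, ht⟩ := h
  set C0 := C k (sl φ U (φ x)) A x with hC0
  have htC : t ∉ C0 := by
    intro h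
    have := (mem_sl.1 (C_subset _ _ _ _ h)).2
    omega
  have hall : ∀ p, p ∈ YY k φ U A →
      Relation.ReflTransGen (fun u v => v ∈ neighbors u ∧ v ∈ YY k φ U A) p t →
      (conn (YY k φ (U \ C0) A) p t ∧ p ∉ C0) ∨
        ∃ z ∈ C0, conn (YY k φ (U \ C0) A) (σ z) t := by
    intro p hpY hpt
    induction hpt using Relation.ReflTransGen.head_induction_on with
    | refl => exact Or.inl ⟨conn.refl (YY_sdiff hpY htC), htC⟩
    | @head p p' hstep _ ih =>
      rcases ih hstep.2 with ⟨h1, h2⟩ | h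
      · by_cases hpC : p ∈ C0
        · right
          refine ⟨p, hpC, ?_⟩
          have hpφ := (mem_sl.1 (C_subset _ _ _ _ hpC)).2
          have hne : φ p ≠ φ p' := by
            intro heq
            apply h2
            have := mem_YY.1 hstep.2
            rw [← heq, hpφ] at this
            exact mem_comp.2 ((mem_comp.1 hpC).step hstep.1 this)
          rw [← hφ.1 p p' hstep.1 hne]
          exact h1
        · left
          have hpY' := YY_sdiff hpY hpC
          exact ⟨((conn.refl hpY').step hstep.1 h1.1).trans h1, hpC⟩
      · exact Or.inr h
  rcases hall x hx hp with ⟨_, h⟩ | ⟨z, hz, h⟩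
  · exact absurd (mem_comp.2 (conn.refl (mem_YY.1 hx))) h
  · exact ⟨z, hz, t, h, ht⟩

/-- Harris-type decoupling. -/
lemma EE_decouple {q : ℝ} (h0 : 0 ≤ q) (h1 : q ≤ 1) {k : ℕ} {U R A0 : Finset (Site d)}
    (hA0 : A0 ⊆ U) (x : Site d) (g : Finset (Site d) → ℝ)
    (hg : ∀ A B, A ⊆ B → g A ≤ g B) (hgr : ∀ A, g A = g (A ∩ (U \ A0))) :
    EE q U (fun A => ind (C k R A x = A0) * g A) ≤
      EE q U (fun A => ind (C k R A x = A0)) * EE q (U \ A0) g := by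
  have hU : A0 ∪ (U \ A0) = U := Finset.union_sdiff_of_subset hA0
  have hs : ∀ f, EE q U f = EE q A0 (fun A => EE q (U \ A0) (fun B => f (A ∪ B))) := by
    intro f
    rw [← EE_split q _ _ Finset.disjoint_sdiff, hU]
  rw [hs, hs (fun A => ind (C k R A x = A0)), ← EE_mul_const]
  apply EE_mono h0 h1
  intro F hF
  have e : EE q (U \ A0) (fun B => ind (C k R (F ∪ B) x = A0) * g (F ∪ B)) =
      EE q (U \ A0) (fun B => ind (C k R (F ∪ B) x = A0) * g B) := by
    apply EE_congr
    intro B hB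
    rw [hgr (F ∪ B), hgr B]
    congr 2
    ext y
    simp only [Finset.mem_inter, Finset.mem_union, Finset.mem_sdiff]
    constructor
    · rintro ⟨h | h, h2⟩
      · exact absurd (hF h) h2.2
      · exact ⟨h, h2⟩
    · rintro ⟨h, h2⟩
      exact ⟨Or.inr h, h2⟩
  rw [e]
  apply EE_harris h0 h1
  · intro B' B hB hBU
    apply ind_mono
    intro h
    exact C_key h hB (Finset.disjoint_of_subset_left hBU Finset.sdiff_disjoint)
  · intro B' B hB _
    exact hg _ _ hB

lemma chain {q : ℝ} (h0 : 0 ≤ q) (h1 : q ≤ 1) {k : ℕ} {φ : Site d → ℤ} {σ : Site d → Site d}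
    (hφ : SlabFn φ σ) {w : ℝ} (hw0 : 0 ≤ w) (hw1 : w ≤ 1) (V : Finset (Site d))
    (hw : ∀ U ⊆ V, ∀ x, EE q U (fun A => ((C k (sl φ U (φ x)) A x).card : ℝ)) ≤ w) (M : ℤ) :
    ∀ U ⊆ V, ∀ x, EE q U (fun A => ind (TT k φ M U A x)) ≤ w ^ (M - φ x + 1).toNat := by
  intro U
  induction U using Finset.strongInduction with
  | H U ih =>
  intro hUV x
  rcases lt_trichotomy (φ x) M with hlt | heq | hgt
  · have hn : ∃ n : ℕ, (M - φ x + 1).toNat = n + 1 := ⟨(M - φ x).toNat, by omega⟩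
    obtain ⟨n, hn⟩ := hn
    rw [hn]
    calc EE q U (fun A => ind (TT k φ M U A x))
        ≤ EE q U (fun A => ∑ A0 ∈ U.powerset, ∑ z ∈ A0,
            ind (C k (sl φ U (φ x)) A x = A0) * ind (TT k φ M (U \ A0) A (σ z))) := by
          apply EE_mono h0 h1
          intro A hA
          have hnn : ∀ A0 ∈ U.powerset, 0 ≤ ∑ z ∈ A0,
            ind (C k (sl φ U (φ x)) A x = A0) * ind (TT k φ M (U \ A0) A (σ z)) :=
            fun A0 _ => Finset.sum_nonneg
              (fun z _ => mul_nonneg (ind_nonneg _) (ind_nonneg _))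
          by_cases hT : TT k φ M U A x
          · obtain ⟨z, hz, hz'⟩ := TT_decomp hφ hlt hT
            refine le_trans ?_ (Finset.single_le_sum hnn (Finset.mem_powerset.2
              ((C_subset k (sl φ U (φ x)) A x).trans (sl_subset _ _ _))))
            refine le_trans ?_ (Finset.single_le_sum
              (fun z _ => mul_nonneg (ind_nonneg _) (ind_nonneg _)) hz)
            rw [ind_true hT, ind_true rfl, ind_true hz']
            norm_num
          · rw [ind_false hT]; exact Finset.sum_nonneg hnn
      _ = ∑ A0 ∈ U.powerset, ∑ z ∈ A0, EE q U (fun A =>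
            ind (C k (sl φ U (φ x)) A x = A0) * ind (TT k φ M (U \ A0) A (σ z))) := by
          rw [EE_sum]
          apply Finset.sum_congr rfl
          intro A0 _
          rw [EE_sum]
      _ ≤ ∑ A0 ∈ U.powerset, EE q U (fun A =>
            ind (C k (sl φ U (φ x)) A x = A0) * (A0.card : ℝ)) * w ^ n := by
          apply Finset.sum_le_sum
          intro A0 hA0
          have hA0U := Finset.mem_powerset.1 hA0
          rw [EE_mul_const]
          by_cases hne : ∃ A, C k (sl φ U (φ x)) A x = A0 ∧ A0.Nonempty
          · obtain ⟨A1, hA1, hne'⟩ := hne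
            have hss : U \ A0 ⊂ U := Finset.sdiff_ssubset hA0U hne'
            calc _ ≤ ∑ z ∈ A0, EE q U (fun A => ind (C k (sl φ U (φ x)) A x = A0)) * w ^ n := by
                  apply Finset.sum_le_sum
                  intro z hz
                  refine (EE_decouple h0 h1 hA0U x
                    (fun A => ind (TT k φ M (U \ A0) A (σ z))) ?_ ?_).trans ?_
                  · intro A B hAB
                    exact ind_mono (TT_mono (Finset.inter_subset_left.trans hAB))
                  · intro A
                    exact congrArg ind (propext TT_inter)
                  · apply mul_le_mul_of_nonneg_left _
                      (EE_nonneg h0 h1 (fun A _ => ind_nonneg _))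
                    refine (ih _ hss (Finset.sdiff_subset.trans hUV) (σ z)).trans ?_
                    apply pow_le_pow_of_le_one hw0 hw1
                    have hzφ : φ z = φ x := by
                      rw [← hA1] at hz
                      exact (mem_sl.1 (C_subset _ _ _ _ hz)).2
                    have := hφ.2 z
                    omega
              _ = _ := by rw [Finset.sum_const, nsmul_eq_mul]; ring
          · have hz : A0 = ∅ ∨ ∀ A, C k (sl φ U (φ x)) A x ≠ A0 := by
              by_contra hcon
              push Not at hcon
              obtain ⟨h1, A, h2⟩ := hcon
              exact hne ⟨A, h2, h1⟩
            rcases hz with rfl | hz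
            · simp
            · have : ∀ A, ind (C k (sl φ U (φ x)) A x = A0) = 0 := fun A => ind_false (hz A)
              simp only [this, zero_mul, EE_const]
              simp
      _ = EE q U (fun A => ((C k (sl φ U (φ x)) A x).card : ℝ)) * w ^ n := by
          rw [← Finset.sum_mul, ← EE_sum]
          congr 1
          apply EE_congr
          intro A hA
          rw [Finset.sum_eq_single (C k (sl φ U (φ x)) A x)]
          · rw [ind_true rfl, one_mul]
          · intro A0 _ hne
            rw [ind_false (fun h => hne h.symm), zero_mul]
          · intro h
            exact absurd (Finset.mem_powerset.2
              ((C_subset k (sl φ U (φ x)) A x).trans (sl_subset _ _ _))) h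
      _ ≤ w ^ (n + 1) := by
          rw [pow_succ, mul_comm]
          exact mul_le_mul_of_nonneg_left (hw U hUV x) (pow_nonneg hw0 _)
  · have : (M - φ x + 1).toNat = 1 := by omega
    rw [this, pow_one]
    refine le_trans (EE_mono h0 h1 ?_) (hw U hUV x)
    intro A hA
    by_cases hT : TT k φ M U A x
    · rw [ind_true hT]
      obtain ⟨t, ht, _⟩ := hT
      have : x ∈ C k (sl φ U (φ x)) A x := mem_comp.2 (conn.refl (mem_YY.1 ht.1))
      have := Finset.card_pos.2 ⟨x, this⟩
      exact_mod_cast this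
    · rw [ind_false hT]; positivity
  · have : (M - φ x + 1).toNat = 0 := by omega
    rw [this, pow_zero]
    calc _ ≤ EE q U (fun _ => 1) := EE_mono h0 h1 (fun A _ => ind_le_one _)
      _ = 1 := EE_const _ _ _

end Slabs

/-! ### Geometry -/

section Geometry

/-- Slab index in direction `i`. -/
def phi (i : Fin d) (pos : Bool) (z : Site d) : ℤ := if pos then z i / 2 else -(z i / 2)

/-- The unique neighbour in another slab. -/
def sig (i : Fin d) (u : Site d) : Site d :=
  Function.update u i (if u i % 2 = 0 then u i - 1 else u i + 1)

lemma slabFn_phi (i : Fin d) (pos : Bool) : SlabFn (phi i pos) (sig i) := by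
  constructor
  · intro u v huv hne
    obtain ⟨j, s, rfl⟩ := mem_neighbors.1 huv
    by_cases hj : j = i
    · subst hj
      unfold sig
      congr 1
      cases pos <;> cases s <;> simp [phi] at hne ⊢ <;> (try split_ifs) <;> omega
    · exfalso
      apply hne
      have : i ≠ j := fun h => hj h.symm
      simp [phi, Function.update_of_ne this]
  · intro u
    cases pos <;> simp [phi, sig] <;> split_ifs <;> omega

lemma SlabFn.step {φ : Site d → ℤ} {σ : Site d → Site d} (hφ : SlabFn φ σ) {u v : Site d}
    (h : v ∈ neighbors u) : φ v ≤ φ u + 1 := by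
  by_cases hh : φ u = φ v
  · omega
  · rw [hφ.1 u v h hh]; exact hφ.2 u

lemma conn_ivt {φ : Site d → ℤ} {σ : Site d → Site d} (hφ : SlabFn φ σ) {X : Finset (Site d)}
    {x y : Site d} (h : conn X x y) {j : ℤ} (hx : φ x ≤ j) (hy : j ≤ φ y) :
    ∃ z ∈ X, φ z = j := by
  have hyX := h.mem_right
  obtain ⟨h1, h2⟩ := h
  induction h2 with
  | refl => exact ⟨x, h1, le_antisymm hx hy⟩
  | @tail b c h h' ih =>
    by_cases hb : j ≤ φ b
    · exact ih hb (conn.mem_right ⟨h1, h⟩)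
    · have := hφ.step h'.1
      exact ⟨c, hyX, by omega⟩

lemma cl_two_hit {φ : Site d → ℤ} {σ : Site d → Site d} (hφ : SlabFn φ σ)
    {V A : Finset (Site d)} {z : Site d} (hz : z ∈ cl 2 V A) : ∃ a ∈ A, φ a = φ z := by
  have h := mem_YY.1 (cl_subset_YY hφ V A hz)
  by_contra hcon
  push Not at hcon
  have : Stab 1 (sl φ V (φ z)) A ∅ := by
    constructor
    · intro y hy
      obtain ⟨h1, h2⟩ := Finset.mem_inter.1 hy
      exact absurd (mem_sl.1 h2).2 (hcon y h1)
    · intro y _ hk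
      simp at hk
  exact absurd (cl_min this h) (Finset.notMem_empty z)

/-- The cluster of `x` reaches distance `m` in one of the directions of `E`. -/
def reach (k : ℕ) (E : Finset (Fin d)) (V A : Finset (Site d)) (x : Site d) (m : ℕ) : Prop :=
  ∃ y ∈ C k V A x, ∃ i ∈ E, (m : ℤ) ≤ |y i - x i|

lemma phi_reach (x y : Site d) (i : Fin d) (m : ℕ) (h : (m : ℤ) ≤ |y i - x i|) :
    ∃ pos, phi i pos x + ((m / 2 : ℕ) : ℤ) ≤ phi i pos y := by
  rcases le_total 0 (y i - x i) with h' | h'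
  · rw [abs_of_nonneg h'] at h
    refine ⟨true, ?_⟩
    simp only [phi, if_true]
    omega
  · rw [abs_of_nonpos h'] at h
    refine ⟨false, ?_⟩
    simp only [phi]
    simp
    omega

lemma card_box (W : Finset (Site d)) (b : Fin d → ℕ)
    (h : ∀ x ∈ W, ∀ y ∈ W, ∀ j, |x j - y j| ≤ (b j : ℤ)) : W.card ≤ ∏ j, (b j + 1) := by
  have hsub : W ⊆ Fintype.piFinset (fun j => W.image (fun x => x j)) := by
    intro x hx
    rw [Fintype.mem_piFinset]
    intro j
    exact Finset.mem_image_of_mem _ hx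
  refine (Finset.card_le_card hsub).trans ?_
  rw [Fintype.card_piFinset]
  apply Finset.prod_le_prod' 
  intro j _
  rcases W.eq_empty_or_nonempty with rfl | hne
  · simp
  · have hne' : (W.image (fun x => x j)).Nonempty := hne.image _
    set a := (W.image (fun x => x j)).min' hne' with ha
    have ham : a ∈ W.image (fun x => x j) := Finset.min'_mem _ _
    obtain ⟨xa, hxa, hxa'⟩ := Finset.mem_image.1 ham
    have hs : W.image (fun x => x j) ⊆ Finset.Icc a (a + b j) := by
      intro t ht
      have h1 := Finset.min'_le _ t ht
      obtain ⟨y, hy, rfl⟩ := Finset.mem_image.1 ht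
      have h2 := (abs_le.1 (h y hy xa hxa j)).2
      rw [Finset.mem_Icc]
      refine ⟨h1, ?_⟩
      omega
    have := Finset.card_le_card hs
    rw [Int.card_Icc] at this
    omega

/-- `V` is thin outside the directions of `E`, and of diameter at most `r`. -/
def thin (E : Finset (Fin d)) (V : Finset (Site d)) (r : ℕ) : Prop :=
  ∀ x ∈ V, ∀ y ∈ V, (∀ i, i ∉ E → |x i - y i| ≤ 1) ∧ ∀ i, |x i - y i| ≤ (r : ℤ)

lemma thin.subset {E : Finset (Fin d)} {V V' : Finset (Site d)} {r : ℕ} (h : thin E V r)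
    (hV : V' ⊆ V) : thin E V' r := fun x hx y hy => h x (hV hx) y (hV hy)

lemma thin_card {E : Finset (Fin d)} {V : Finset (Site d)} {r : ℕ} (h : thin E V r) :
    V.card ≤ (r + 1) ^ d := by
  have := card_box V (fun _ => r) (fun x hx y hy j => (h x hx y hy).2 j)
  simpa using this

lemma sl_phi_diff {i : Fin d} {pos : Bool} {V : Finset (Site d)} {j : ℤ} {x y : Site d}
    (hx : x ∈ sl (phi i pos) V j) (hy : y ∈ sl (phi i pos) V j) : |x i - y i| ≤ 1 := by
  have h1 := (mem_sl.1 hx).2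
  have h2 := (mem_sl.1 hy).2
  rw [abs_le]
  cases pos <;> simp [phi] at h1 h2 <;> constructor <;> omega

lemma thin_sl {E : Finset (Fin d)} {V : Finset (Site d)} {r : ℕ} (h : thin E V r) (i : Fin d)
    (pos : Bool) (j : ℤ) : thin (E.erase i) (sl (phi i pos) V j) r := by
  intro x hx y hy
  refine ⟨?_, (h x (sl_subset _ _ _ hx) y (sl_subset _ _ _ hy)).2⟩
  intro l hl
  by_cases hli : l = i
  · subst hli; exact sl_phi_diff hx hy
  · exact (h x (sl_subset _ _ _ hx) y (sl_subset _ _ _ hy)).1 l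
      (fun hE => hl (Finset.mem_erase.2 ⟨hli, hE⟩))

lemma thin_sl_card {E : Finset (Fin d)} {V : Finset (Site d)} {r : ℕ} (h : thin E V r) {i : Fin d}
    (pos : Bool) (j : ℤ) :
    (sl (phi i pos) V j).card ≤ 2 ^ d * (r + 1) ^ (E.erase i).card := by
  have ht := thin_sl h i pos j
  have := card_box (sl (phi i pos) V j) (fun l => if l ∈ E.erase i then r else 1) (by
    intro x hx y hy l
    split_ifs with hl
    · exact (ht x hx y hy).2 l
    · exact_mod_cast (ht x hx y hy).1 l hl)
  refine this.trans ?_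
  calc ∏ l, ((if l ∈ E.erase i then r else 1) + 1)
      ≤ ∏ l : Fin d, 2 * (if l ∈ E.erase i then (r + 1) else 1) := by
        apply Finset.prod_le_prod'
        intro l _
        split_ifs <;> omega
    _ = 2 ^ d * (r + 1) ^ (E.erase i).card := by
        rw [Finset.prod_mul_distrib]
        congr 1
        · simp
        · rw [Finset.prod_ite_mem, Finset.univ_inter, Finset.prod_const]

/-- Size of a cluster in terms of its reach. -/
lemma card_C_le {k : ℕ} {E : Finset (Fin d)} {V A : Finset (Site d)} {r : ℕ} (hE : E.Nonempty)
    (hV : thin E V r) (x : Site d) :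
    ((C k V A x).card : ℝ) ≤
      ∑ m ∈ Finset.range (r + 1), (2 * (m : ℝ) + 3) ^ d * ind (reach k E V A x m) := by
  have hnn : ∀ m ∈ Finset.range (r + 1),
      0 ≤ (2 * (m : ℝ) + 3) ^ d * ind (reach k E V A x m) :=
    fun m _ => mul_nonneg (by positivity) (ind_nonneg _)
  rcases (C k V A x).eq_empty_or_nonempty with he | ⟨y0, hy0⟩
  · rw [he]; simp only [Finset.card_empty, Nat.cast_zero]; exact Finset.sum_nonneg hnn
  have hx : x ∈ C k V A x := mem_C_self hy0
  have hP0 : reach k E V A x 0 := by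
    obtain ⟨i, hi⟩ := hE
    exact ⟨x, hx, i, hi, by simp⟩
  set m := Nat.findGreatest (fun m => reach k E V A x m) r with hm
  have hPm : reach k E V A x m :=
    Nat.findGreatest_spec (P := fun m => reach k E V A x m) (Nat.zero_le r) hP0
  have hmr : m ≤ r := Nat.findGreatest_le r
  have hxV := C_subset _ _ _ _ hx
  have hdist : ∀ y ∈ C k V A x, ∀ i, |y i - x i| ≤ (m : ℤ) + 1 := by
    intro y hy i
    have hyV := C_subset _ _ _ _ hy
    by_cases hi : i ∈ E
    · by_contra hcon
      push Not at hcon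
      have h1 : reach k E V A x (m + 1) := ⟨y, hy, i, hi, by push_cast; omega⟩
      have h2 : m + 1 ≤ r := by
        have := (hV y hyV x hxV).2 i
        omega
      have := Nat.le_findGreatest (P := fun m => reach k E V A x m) h2 h1
      omega
    · have := (hV y hyV x hxV).1 i hi
      omega
  have hc := card_box (C k V A x) (fun _ => 2 * m + 2) (by
    intro y hy z hz j
    have h1 := abs_le.1 (hdist y hy j)
    have h2 := abs_le.1 (hdist z hz j)
    rw [abs_le]
    push_cast
    constructor <;> omega)
  simp only [Finset.prod_const, Finset.card_univ, Fintype.card_fin] at hc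
  refine le_trans ?_ (Finset.single_le_sum hnn (Finset.mem_range.2 (Nat.lt_succ_of_le hmr)))
  rw [ind_true hPm, mul_one]
  have : ((C k V A x).card : ℝ) ≤ ((2 * m + 2 + 1) ^ d : ℕ) := by exact_mod_cast hc
  refine this.trans (le_of_eq ?_)
  push_cast
  ring

/-- The ball of radius `ρ` in `S`. -/
def ball (S : Finset (Site d)) (v : Site d) (ρ : ℕ) : Finset (Site d) :=
  S.filter fun y => ∀ i, |y i - v i| ≤ (ρ : ℤ)

lemma mem_ball {S : Finset (Site d)} {v y : Site d} {ρ : ℕ} :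
    y ∈ ball S v ρ ↔ y ∈ S ∧ ∀ i, |y i - v i| ≤ (ρ : ℤ) := Finset.mem_filter

lemma thin_ball {E : Finset (Fin d)} {V : Finset (Site d)} {r : ℕ} (h : thin E V r) (v : Site d)
    (ρ : ℕ) : thin E (ball V v ρ) (2 * ρ) := by
  intro x hx y hy
  obtain ⟨hxV, hx⟩ := mem_ball.1 hx
  obtain ⟨hyV, hy⟩ := mem_ball.1 hy
  refine ⟨(h x hxV y hyV).1, fun i => ?_⟩
  have h1 := abs_le.1 (hx i)
  have h2 := abs_le.1 (hy i)
  rw [abs_le]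
  push_cast
  constructor <;> omega

/-- Localization: if no local cluster is large, clusters are local. -/
lemma localize {k : ℕ} {E : Finset (Fin d)} {S A : Finset (Site d)} {r p : ℕ} (hS : thin E S r)
    (hp : 1 ≤ p) (hno : ∀ v ∈ S, ¬ reach k E (ball S v (2 * p + 1)) A v p) (x : Site d) :
    C k S A x ⊆ C k (ball S x (2 * p + 1)) A x := by
  set D : Site d → Finset (Site d) := fun v => C k (ball S v (2 * p + 1)) A v with hD
  have hDS : ∀ v, D v ⊆ S := fun v => (C_subset _ _ _ _).trans (Finset.filter_subset _ _)
  -- the local clusters are small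
  have hsmall : ∀ v, ∀ y ∈ D v, ∀ i, |y i - v i| ≤ (p : ℤ) := by
    intro v y hy i
    have hvS : v ∈ S := hDS v (mem_C_self hy)
    have hyS : y ∈ S := hDS v hy
    by_cases hi : i ∈ E
    · by_contra hcon
      push Not at hcon
      exact hno v hvS ⟨y, hy, i, hi, hcon.le⟩
    · have := (hS y hyS v hvS).1 i hi
      omega
  have hloc : ∀ u v, (∀ y ∈ D v, ∀ i, |y i - u i| ≤ (2 * p + 1 : ℤ)) →
      D v ⊆ cl k (ball S u (2 * p + 1)) A := by
    intro u v h
    apply C_subset_cl _ Finset.inter_subset_left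
    intro y hy
    exact mem_ball.2 ⟨hDS v hy, by simpa using h y hy⟩
  -- the set of locally infected sites
  set X : Finset (Site d) := S.filter (fun v => v ∈ D v) with hX
  have hXst : Stab k S A X := by
    constructor
    · intro v hv
      obtain ⟨h1, h2⟩ := Finset.mem_inter.1 hv
      have hb : v ∈ ball S v (2 * p + 1) := mem_ball.2 ⟨h2, by intro i; simp; positivity⟩
      exact Finset.mem_filter.2 ⟨h2, mem_comp.2 (conn.refl
        ((cl_stab _ _ _).1 (Finset.mem_inter.2 ⟨h1, hb⟩)))⟩
    · intro v hv hk
      have hb : v ∈ ball S v (2 * p + 1) := mem_ball.2 ⟨hv, by intro i; simp; positivity⟩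
      refine Finset.mem_filter.2 ⟨hv, mem_comp.2 (conn.refl ((cl_stab _ _ _).2 v hb
        (hk.trans (Finset.card_le_card ?_))))⟩
      intro u hu
      obtain ⟨hun, huX⟩ := Finset.mem_inter.1 hu
      refine Finset.mem_inter.2 ⟨hun, ?_⟩
      refine hloc v u ?_ (Finset.mem_filter.1 huX).2
      intro y hy i
      have h1 := abs_le.1 (hsmall u y hy i)
      have h2 := abs_le.1 (neighbors_dist hun i)
      rw [abs_le]; constructor <;> omega
  have hstep : ∀ b, conn X x b → b ∈ D x := by
    rintro b ⟨hx, hb⟩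
    induction hb with
    | refl => exact (Finset.mem_filter.1 hx).2
    | @tail b c h h' ih =>
      have hc : c ∈ D c := (Finset.mem_filter.1 h'.2).2
      have hcl : D c ⊆ cl k (ball S x (2 * p + 1)) A := by
        apply hloc
        intro y hy i
        have h1 := abs_le.1 (hsmall c y hy i)
        have h2 := abs_le.1 (neighbors_dist h'.1 i)
        have h3 := abs_le.1 (hsmall x b ih i)
        rw [abs_le]; constructor <;> omega
      exact mem_comp.2 ((mem_comp.1 ih).step h'.1 (hcl hc))
  intro b hb
  exact hstep b ((mem_comp.1 hb).mono (cl_min hXst))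

end Geometry

/-! ### The induction -/

section Induction

lemma reach_inter {k : ℕ} {E : Finset (Fin d)} {V A : Finset (Site d)} {x : Site d} {m : ℕ} :
    ind (reach k E V A x m) = ind (reach k E V (A ∩ V) x m) := by
  unfold reach; rw [← C_inter]

lemma card_C_inter {k : ℕ} {V A : Finset (Site d)} {x : Site d} :
    ((C k V A x).card : ℝ) = ((C k V (A ∩ V) x).card : ℝ) := by
  rw [← C_inter]

/-- The constant of the cluster size bound. -/
def KK (d : ℕ) : ℝ := ∑' m : ℕ, (2 * (m : ℝ) + 3) ^ d * (1 / 2) ^ m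

lemma KK_summable (d : ℕ) : Summable (fun m : ℕ => (2 * (m : ℝ) + 3) ^ d * (1 / 2 : ℝ) ^ m) := by
  have h1 : Summable (fun m : ℕ => (m : ℝ) ^ d * (1 / 2 : ℝ) ^ m) :=
    summable_pow_mul_geometric_of_norm_lt_one d (by norm_num)
  have h2 : Summable (fun m : ℕ => ((m + 1 : ℕ) : ℝ) ^ d * (1 / 2 : ℝ) ^ (m + 1)) :=
    (summable_nat_add_iff (f := fun m : ℕ => (m : ℝ) ^ d * (1 / 2 : ℝ) ^ m) 1).2 h1
  refine Summable.of_nonneg_of_le (fun m => by positivity) (fun m => ?_) (h2.mul_left (3 ^ d * 2))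
  have h3 : (2 * (m : ℝ) + 3) ^ d ≤ (3 * ((m : ℝ) + 1)) ^ d := by
    apply pow_le_pow_left₀ (by positivity)
    have : (0 : ℝ) ≤ m := Nat.cast_nonneg m
    linarith
  calc _ ≤ (3 * ((m : ℝ) + 1)) ^ d * (1 / 2) ^ m := by gcongr
    _ = _ := by rw [mul_pow]; push_cast; ring

lemma KK_pos (d : ℕ) : 0 < KK d :=
  (KK_summable d).tsum_pos (fun m => by positivity) 0 (by positivity)

lemma mean_card {q : ℝ} (h0 : 0 ≤ q) (h1 : q ≤ 1) {k : ℕ} {E : Finset (Fin d)}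
    {S : Finset (Site d)} {r p : ℕ} {ε : ℝ} (hE : E.Nonempty) (hS : thin E S r) (hp : 1 ≤ p)
    (hε0 : 0 < ε) (hε : ε ≤ 1 / 2)
    (hH : ∀ V, thin E V (2 * (2 * p + 1)) → ∀ x m,
      EE q V (fun A => ind (reach k E V A x m)) ≤ ε ^ (m + 1)) (x : Site d) :
    EE q S (fun A => ((C k S A x).card : ℝ)) ≤ KK d * ε + ((r : ℝ) + 1) ^ (2 * d) * ε ^ (p + 1) := by
  have hb : ∀ v, ball S v (2 * p + 1) ⊆ S := fun v => Finset.filter_subset _ _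
  have hScard : (S.card : ℝ) ≤ ((r : ℝ) + 1) ^ d := by exact_mod_cast thin_card hS
  calc EE q S (fun A => ((C k S A x).card : ℝ))
      ≤ EE q S (fun A => ((C k (ball S x (2 * p + 1)) A x).card : ℝ) +
          (S.card : ℝ) * ∑ v ∈ S, ind (reach k E (ball S v (2 * p + 1)) A v p)) := by
        apply EE_mono h0 h1
        intro A _
        by_cases hno : ∀ v ∈ S, ¬ reach k E (ball S v (2 * p + 1)) A v p
        · have := Finset.card_le_card (localize hS hp hno x)
          have h' : ((C k S A x).card : ℝ) ≤ ((C k (ball S x (2 * p + 1)) A x).card : ℝ) := by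
            exact_mod_cast this
          have : 0 ≤ (S.card : ℝ) * ∑ v ∈ S, ind (reach k E (ball S v (2 * p + 1)) A v p) :=
            mul_nonneg (by positivity) (Finset.sum_nonneg (fun _ _ => ind_nonneg _))
          linarith
        · push Not at hno
          obtain ⟨v, hv, hr⟩ := hno
          have h2 : ((C k S A x).card : ℝ) ≤ (S.card : ℝ) := by
            exact_mod_cast Finset.card_le_card (C_subset k S A x)
          have h3 : (1 : ℝ) ≤ ∑ v ∈ S, ind (reach k E (ball S v (2 * p + 1)) A v p) := by
            refine le_trans ?_ (Finset.single_le_sum (fun _ _ => ind_nonneg _) hv)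
            rw [ind_true hr]
          have h4 : (0 : ℝ) ≤ ((C k (ball S x (2 * p + 1)) A x).card : ℝ) := by positivity
          have h5 : (S.card : ℝ) * 1 ≤ (S.card : ℝ) *
            ∑ v ∈ S, ind (reach k E (ball S v (2 * p + 1)) A v p) :=
            mul_le_mul_of_nonneg_left h3 (by positivity)
          linarith
    _ = EE q (ball S x (2 * p + 1)) (fun A => ((C k (ball S x (2 * p + 1)) A x).card : ℝ)) +
          (S.card : ℝ) * ∑ v ∈ S, EE q (ball S v (2 * p + 1))
            (fun A => ind (reach k E (ball S v (2 * p + 1)) A v p)) := by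
        rw [EE_add, EE_const_mul, EE_sum]
        congr 1
        · exact EE_restrict q (hb x) _ (fun A => card_C_inter)
        · congr 1
          apply Finset.sum_congr rfl
          intro v _
          exact EE_restrict q (hb v) _ (fun A => reach_inter)
    _ ≤ KK d * ε + ((r : ℝ) + 1) ^ d * (((r : ℝ) + 1) ^ d * ε ^ (p + 1)) := by
        apply add_le_add
        · have ht := thin_ball hS x (2 * p + 1)
          calc _ ≤ EE q (ball S x (2 * p + 1)) (fun A =>
                ∑ m ∈ Finset.range (2 * (2 * p + 1) + 1), (2 * (m : ℝ) + 3) ^ d *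
                  ind (reach k E (ball S x (2 * p + 1)) A x m)) :=
                EE_mono h0 h1 (fun A _ => card_C_le hE ht x)
            _ = ∑ m ∈ Finset.range (2 * (2 * p + 1) + 1), (2 * (m : ℝ) + 3) ^ d *
                  EE q (ball S x (2 * p + 1)) (fun A =>
                    ind (reach k E (ball S x (2 * p + 1)) A x m)) := by
                rw [EE_sum]
                apply Finset.sum_congr rfl
                intro m _
                rw [EE_const_mul]
            _ ≤ ∑ m ∈ Finset.range (2 * (2 * p + 1) + 1),
                  ((2 * (m : ℝ) + 3) ^ d * (1 / 2) ^ m) * ε := by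
                apply Finset.sum_le_sum
                intro m _
                calc _ ≤ (2 * (m : ℝ) + 3) ^ d * ε ^ (m + 1) := by
                      gcongr; exact hH _ ht x m
                  _ = (2 * (m : ℝ) + 3) ^ d * ε ^ m * ε := by ring
                  _ ≤ _ := by gcongr
            _ ≤ KK d * ε := by
                rw [← Finset.sum_mul]
                gcongr
                exact (KK_summable d).sum_le_tsum _ (fun m _ => by positivity)
        · have hs : ∑ v ∈ S, EE q (ball S v (2 * p + 1))
              (fun A => ind (reach k E (ball S v (2 * p + 1)) A v p)) ≤
              (S.card : ℝ) * ε ^ (p + 1) := by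
            calc _ ≤ ∑ v ∈ S, ε ^ (p + 1) :=
                  Finset.sum_le_sum (fun v _ => hH _ (thin_ball hS v _) v p)
              _ = _ := by rw [Finset.sum_const, nsmul_eq_mul]
          calc _ ≤ (S.card : ℝ) * ((S.card : ℝ) * ε ^ (p + 1)) := by gcongr
            _ ≤ _ := by gcongr
    _ = _ := by ring

/-- Union over directions. -/
lemma dir_union {q : ℝ} (h0 : 0 ≤ q) (h1 : q ≤ 1) {V : Finset (Site d)} (E : Finset (Fin d))
    (P : Finset (Site d) → Prop) (Q : Fin d → Bool → Finset (Site d) → Prop) (b : ℝ) (hb : 0 ≤ b)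
    (hPQ : ∀ A, P A → ∃ i ∈ E, ∃ pos, Q i pos A)
    (hQ : ∀ i ∈ E, ∀ pos, EE q V (fun A => ind (Q i pos A)) ≤ b) :
    EE q V (fun A => ind (P A)) ≤ 2 * d * b := by
  calc _ ≤ EE q V (fun A => ∑ i ∈ E, ∑ pos : Bool, ind (Q i pos A)) := by
        apply EE_mono h0 h1
        intro A _
        by_cases hP : P A
        · obtain ⟨i, hi, pos, h⟩ := hPQ A hP
          rw [ind_true hP]
          refine le_trans ?_ (Finset.single_le_sum
            (fun i _ => Finset.sum_nonneg (fun pos _ => ind_nonneg _)) hi)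
          refine le_trans ?_ (Finset.single_le_sum
            (fun pos _ => ind_nonneg _) (Finset.mem_univ pos))
          rw [ind_true h]
        · rw [ind_false hP]
          exact Finset.sum_nonneg (fun i _ => Finset.sum_nonneg (fun pos _ => ind_nonneg _))
    _ = ∑ i ∈ E, ∑ pos : Bool, EE q V (fun A => ind (Q i pos A)) := by
        rw [EE_sum]
        apply Finset.sum_congr rfl
        intro i _
        rw [EE_sum]
    _ ≤ ∑ i ∈ E, ∑ pos : Bool, b :=
        Finset.sum_le_sum (fun i hi => Finset.sum_le_sum (fun pos _ => hQ i hi pos))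
    _ = (E.card : ℝ) * (2 * b) := by simp
    _ ≤ (d : ℝ) * (2 * b) := by
        gcongr
        have := Finset.card_le_univ E
        simpa using this
    _ = _ := by ring

lemma reach_step {q : ℝ} (h0 : 0 ≤ q) (h1 : q ≤ 1) {k : ℕ} {E : Finset (Fin d)}
    {V : Finset (Site d)} {w : ℝ} (hw0 : 0 ≤ w) (hw1 : w ≤ 1)
    (hw : ∀ i ∈ E, ∀ pos j, ∀ S ⊆ sl (phi i pos) V j, ∀ x,
      EE q S (fun A => ((C k S A x).card : ℝ)) ≤ w) (x : Site d) (m : ℕ) :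
    EE q V (fun A => ind (reach (k + 1) E V A x m)) ≤ 2 * d * w ^ (m / 2 + 1) := by
  apply dir_union h0 h1 E _
    (fun i pos A => TT k (phi i pos) (phi i pos x + ((m / 2 : ℕ) : ℤ)) V A x) _ (by positivity)
  · rintro A ⟨y, hy, i, hi, hm⟩
    obtain ⟨pos, hpos⟩ := phi_reach x y i m hm
    exact ⟨i, hi, pos, y, (mem_comp.1 hy).mono (cl_subset_YY (slabFn_phi i pos) V A), hpos⟩
  · intro i hi pos
    have hw' : ∀ U ⊆ V, ∀ z, EE q U (fun A =>
        ((C k (sl (phi i pos) U (phi i pos z)) A z).card : ℝ)) ≤ w := by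
      intro U hU z
      have e := EE_restrict q (sl_subset (phi i pos) U (phi i pos z))
        (fun A => ((C k (sl (phi i pos) U (phi i pos z)) A z).card : ℝ))
        (fun A => card_C_inter)
      rw [e]
      refine hw i hi pos (phi i pos z) _ ?_ z
      intro y hy
      obtain ⟨h1, h2⟩ := mem_sl.1 hy
      exact mem_sl.2 ⟨hU h1, h2⟩
    have := chain h0 h1 (k := k) (slabFn_phi i pos) hw0 hw1 V hw'
      (phi i pos x + ((m / 2 : ℕ) : ℤ)) V subset_rfl x
    refine this.trans (le_of_eq ?_)
    congr 1
    omega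

lemma reach_base {q : ℝ} (h0 : 0 ≤ q) (h1 : q ≤ 1) {E : Finset (Fin d)}
    {V : Finset (Site d)} {r s : ℕ} (hV : thin E V r) (hE : E.card = s + 2) (x : Site d) (m : ℕ) :
    EE q V (fun A => ind (reach 2 E V A x m)) ≤
      2 * d * (q * (2 ^ d * ((r : ℝ) + 1) ^ (s + 1))) ^ (m / 2 + 1) := by
  apply dir_union h0 h1 E _
    (fun i pos A => ∀ j : ℕ, j < m / 2 + 1 → ∃ z ∈ A, phi i pos z = phi i pos x + j) _
    (by positivity)
  · rintro A ⟨y, hy, i, hi, hm⟩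
    obtain ⟨pos, hpos⟩ := phi_reach x y i m hm
    refine ⟨i, hi, pos, ?_⟩
    intro j hj
    obtain ⟨z, hz, hzφ⟩ := conn_ivt (slabFn_phi i pos) (mem_comp.1 hy)
      (j := phi i pos x + j) (by omega) (by omega)
    rw [← hzφ]
    exact cl_two_hit (slabFn_phi i pos) hz
  · intro i hi pos
    apply EE_fibres h0 h1
    intro j
    have := thin_sl_card hV (i := i) pos j
    rw [Finset.card_erase_of_mem hi, hE] at this
    exact_mod_cast this

lemma fin_bound {ε w : ℝ} (hd : 1 ≤ d) (hε0 : 0 < ε) (hε1 : ε ≤ 1) (hw0 : 0 ≤ w)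
    (hw : w ≤ (ε / (2 * d)) ^ 2) (m : ℕ) : 2 * d * w ^ (m / 2 + 1) ≤ ε ^ (m + 1) := by
  have hd' : (1 : ℝ) ≤ d := by exact_mod_cast hd
  have ha0 : 0 ≤ ε / (2 * d) := by positivity
  have ha1 : ε / (2 * d) ≤ 1 := by
    rw [div_le_one (by positivity)]; linarith
  calc 2 * d * w ^ (m / 2 + 1) ≤ 2 * d * ((ε / (2 * d)) ^ 2) ^ (m / 2 + 1) := by gcongr
    _ = 2 * d * (ε / (2 * d)) ^ (2 * (m / 2 + 1)) := by rw [← pow_mul]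
    _ ≤ 2 * d * (ε / (2 * d)) ^ (m + 1) := by
        gcongr 2 * d * ?_
        apply pow_le_pow_of_le_one ha0 ha1
        omega
    _ = 2 * d * (ε / (2 * d)) * (ε / (2 * d)) ^ m := by ring
    _ = ε * (ε / (2 * d)) ^ m := by
        congr 1; field_simp
    _ ≤ ε * ε ^ m := by
        gcongr
        apply div_le_self hε0.le; linarith
    _ = ε ^ (m + 1) := by ring

lemma expIter_ge (n : ℕ) (x : ℝ) : x ≤ expIter n x := by
  induction n with
  | zero => exact le_rfl
  | succ n ih =>
    have := Real.add_one_le_exp (expIter n x)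
    simp only [expIter]
    linarith

lemma expIter_compare (n : ℕ) : ∀ c0 κ : ℝ, 0 < c0 → 0 < κ → ∃ c T : ℝ, 0 < c ∧ 0 < T ∧
    ∀ t, T ≤ t → expIter n (c * t) ≤ κ * expIter n (c0 * t) := by
  induction n with
  | zero =>
    intro c0 κ h0 hκ
    exact ⟨κ * c0, 1, by positivity, one_pos, fun t _ => by simp only [expIter]; linarith⟩
  | succ n ih =>
    intro c0 κ h0 hκ
    obtain ⟨c, T, hc, hT, h⟩ := ih c0 (1 / 2) h0 (by norm_num)
    refine ⟨c, max T (2 * |Real.log κ| / c0), hc, lt_max_of_lt_left hT, ?_⟩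
    intro t ht
    have h1 := h t (le_trans (le_max_left _ _) ht)
    have h2 : 2 * |Real.log κ| ≤ c0 * t := by
      have := le_trans (le_max_right _ _) ht
      rw [div_le_iff₀ h0] at this
      linarith
    have h3 := expIter_ge n (c0 * t)
    have h4 := neg_abs_le (Real.log κ)
    simp only [expIter]
    calc Real.exp (expIter n (c * t)) ≤ Real.exp (Real.log κ + expIter n (c0 * t)) := by
          apply Real.exp_le_exp.2; linarith
      _ = _ := by rw [Real.exp_add, Real.exp_log hκ]

lemma t_large (s : ℕ) (T : ℝ) : ∃ q1 : ℝ, 0 < q1 ∧ q1 < 1 ∧ ∀ q, 0 < q → q < q1 →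
    T ≤ q ^ (-(1 : ℝ) / ((s : ℝ) + 1)) := by
  set T' := max T 1 with hT'
  have hT1 : 0 < T' := lt_max_of_lt_right one_pos
  refine ⟨min (1 / 2) (T' ^ (-((s : ℝ) + 1))), lt_min (by norm_num) (Real.rpow_pos_of_pos hT1 _),
    lt_of_le_of_lt (min_le_left _ _) (by norm_num), ?_⟩
  intro q hq hq1
  have hq2 : q ≤ T' ^ (-((s : ℝ) + 1)) := (lt_of_lt_of_le hq1 (min_le_right _ _)).le
  have hs : (0 : ℝ) < (s : ℝ) + 1 := by positivity
  have := Real.rpow_le_rpow_of_nonpos hq hq2 (z := -(1 : ℝ) / ((s : ℝ) + 1))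
    (by rw [neg_div]; exact neg_nonpos.2 (by positivity))
  rw [← Real.rpow_mul hT1.le] at this
  have e : -((s : ℝ) + 1) * (-(1 : ℝ) / ((s : ℝ) + 1)) = 1 := by field_simp
  rw [e, Real.rpow_one] at this
  exact (le_max_left _ _).trans this

/-- The inductive statement. -/
def HH (d s k : ℕ) : Prop :=
  ∀ ε : ℝ, 0 < ε → ε ≤ 1 → ∃ c q0 : ℝ, 0 < c ∧ 0 < q0 ∧ q0 < 1 ∧ ∀ q, 0 < q → q < q0 →
    ∀ r : ℕ, (r : ℝ) ≤ expIter (k - 2) (c * q ^ (-(1 : ℝ) / ((s : ℝ) + 1))) →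
      ∀ E : Finset (Fin d), E.card = s + k → ∀ V : Finset (Site d), thin E V r → ∀ x m,
        EE q V (fun A => ind (reach k E V A x m)) ≤ ε ^ (m + 1)

lemma HH_base (hd : 1 ≤ d) (s : ℕ) : HH d s 2 := by
  intro ε hε0 hε1
  have hd' : (1 : ℝ) ≤ d := by exact_mod_cast hd
  set w0 := (ε / (2 * d)) ^ 2 with hw0
  have hw0pos : 0 < w0 := by positivity
  set c := min (1 / 2) (w0 / 2 ^ (d + 1)) with hc
  have hcpos : 0 < c := lt_min (by norm_num) (by positivity)
  obtain ⟨q1, hq1, hq1', hT⟩ := t_large s (1 / c)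
  refine ⟨c, q1, hcpos, hq1, hq1', ?_⟩
  intro q hq hqq r hr E hE V hV x m
  refine (reach_base hq.le (by linarith) hV hE x m).trans ?_
  apply fin_bound hd hε0 hε1 (by positivity)
  set t := q ^ (-(1 : ℝ) / ((s : ℝ) + 1)) with ht
  have ht1 := hT q hq hqq
  have htpos : 0 < t := Real.rpow_pos_of_pos hq _
  have hct : 1 ≤ c * t := by
    rw [div_le_iff₀ hcpos] at ht1; linarith
  have hr' : (r : ℝ) + 1 ≤ 2 * c * t := by
    have : (r : ℝ) ≤ c * t := hr
    linarith
  have htq : q * t ^ (s + 1) = 1 := by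
    rw [ht, ← Real.rpow_natCast, ← Real.rpow_mul hq.le]
    have e : -(1 : ℝ) / ((s : ℝ) + 1) * ((s + 1 : ℕ) : ℝ) = -1 := by
      push_cast; field_simp
    rw [e, Real.rpow_neg_one, mul_inv_cancel₀ hq.ne']
  calc q * (2 ^ d * ((r : ℝ) + 1) ^ (s + 1)) ≤ q * (2 ^ d * (2 * c * t) ^ (s + 1)) := by gcongr
    _ = 2 ^ d * (2 * c) ^ (s + 1) * (q * t ^ (s + 1)) := by rw [mul_pow]; ring
    _ = 2 ^ d * (2 * c) ^ (s + 1) := by rw [htq, mul_one]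
    _ ≤ 2 ^ d * (2 * c) := by
        gcongr
        apply pow_le_of_le_one (by positivity)
        · have := min_le_left (1 / 2) (w0 / 2 ^ (d + 1)); linarith
        · omega
    _ ≤ 2 ^ d * (2 * (w0 / 2 ^ (d + 1))) := by gcongr; exact min_le_right _ _
    _ = w0 := by field_simp; ring

lemma HH_step (hd : 1 ≤ d) (s k : ℕ) (hk : 2 ≤ k) (ih : HH d s k) : HH d s (k + 1) := by
  intro ε1 hε0 hε1
  have hd' : (1 : ℝ) ≤ d := by exact_mod_cast hd
  set w0 := (ε1 / (2 * d)) ^ 2 with hw0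
  have hw0pos : 0 < w0 := by positivity
  have hw01 : w0 ≤ 1 := by
    apply pow_le_one₀ (by positivity)
    rw [div_le_one (by positivity)]; linarith
  have hK := KK_pos d
  set ε := min (1 / 2) (w0 / (2 * KK d)) with hε
  have hεpos : 0 < ε := lt_min (by norm_num) (by positivity)
  have hε2 : ε ≤ 1 / 2 := min_le_left _ _
  have hKε : KK d * ε ≤ w0 / 2 := by
    calc KK d * ε ≤ KK d * (w0 / (2 * KK d)) := by gcongr; exact min_le_right _ _
      _ = w0 / 2 := by field_simp
  obtain ⟨c0, q0, hc0, hq0, hq01, hH⟩ := ih ε hεpos (by linarith)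
  set lam := -Real.log ε with hlam
  have hlampos : 0 < lam := by
    have := Real.log_neg hεpos (by linarith)
    linarith
  obtain ⟨c, T, hc, hT, hcmp⟩ := expIter_compare (k - 2) c0 (lam / (32 * d)) hc0 (by positivity)
  set Lm := max 8 (16 / lam * |Real.log (w0 / 2 / 4 ^ d)|) with hLm
  obtain ⟨q1, hq1, hq11, hq1T⟩ := t_large s (max T (Lm / c0))
  refine ⟨c, min q0 q1, hc, lt_min hq0 hq1, lt_of_le_of_lt (min_le_left _ _) hq01, ?_⟩
  intro q hq hqq r hr E hE V hV x m
  have hqq0 : q < q0 := lt_of_lt_of_le hqq (min_le_left _ _)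
  have hqq1 : q < q1 := lt_of_lt_of_le hqq (min_le_right _ _)
  have hq1' : q ≤ 1 := by linarith
  have ht := hq1T q hq hqq1
  set t := q ^ (-(1 : ℝ) / ((s : ℝ) + 1)) with htdef
  set L := expIter (k - 2) (c0 * t) with hL
  have hLLm : Lm ≤ L := by
    have h1 := le_trans (le_max_right _ _) ht
    rw [div_le_iff₀ hc0] at h1
    have h2 := expIter_ge (k - 2) (c0 * t)
    linarith
  have hL8 : 8 ≤ L := (le_max_left _ _).trans hLLm
  have hLlog : |Real.log (w0 / 2 / 4 ^ d)| ≤ lam * L / 16 := by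
    have h1 := (le_max_right _ _).trans hLLm
    have h2 : 16 / lam * |Real.log (w0 / 2 / 4 ^ d)| * (lam / 16) ≤ L * (lam / 16) := by gcongr
    have h3 : 16 / lam * |Real.log (w0 / 2 / 4 ^ d)| * (lam / 16) =
      |Real.log (w0 / 2 / 4 ^ d)| := by field_simp
    linarith
  set p := ⌊L / 8⌋₊ with hp
  have hp1 : 1 ≤ p := by
    apply Nat.le_floor
    push_cast; linarith
  have hpL : (p : ℝ) ≤ L / 8 := Nat.floor_le (by linarith)
  have hpL' : L / 8 ≤ (p : ℝ) + 1 := (Nat.lt_floor_add_one _).le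
  have hrad : ((2 * (2 * p + 1) : ℕ) : ℝ) ≤ L := by push_cast; linarith
  -- second error term
  have hr1 : (r : ℝ) ≤ Real.exp (lam / (32 * d) * L) := by
    have e : k + 1 - 2 = (k - 2) + 1 := by omega
    rw [e] at hr
    simp only [expIter] at hr
    exact hr.trans (Real.exp_le_exp.2 (hcmp t (le_trans (le_max_left _ _) ht)))
  have hr2 : (r : ℝ) + 1 ≤ 2 * Real.exp (lam / (32 * d) * L) := by
    have : 1 ≤ Real.exp (lam / (32 * d) * L) := Real.one_le_exp (by positivity)
    linarith
  have hr3 : ((r : ℝ) + 1) ^ (2 * d) ≤ 4 ^ d * Real.exp (lam * L / 16) := by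
    calc ((r : ℝ) + 1) ^ (2 * d) ≤ (2 * Real.exp (lam / (32 * d) * L)) ^ (2 * d) := by gcongr
      _ = 4 ^ d * Real.exp (lam * L / 16) := by
          rw [mul_pow, pow_mul, ← Real.exp_nat_mul]
          congr 2
          · norm_num
          · push_cast; field_simp; norm_num
  have hεp : ε ^ (p + 1) ≤ Real.exp (-(lam * L / 8)) := by
    have : ε ^ (p + 1) = Real.exp (((p + 1 : ℕ) : ℝ) * Real.log ε) := by
      rw [Real.exp_nat_mul, Real.exp_log hεpos]
    rw [this]
    apply Real.exp_le_exp.2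
    have h1 : lam * (L / 8) ≤ lam * ((p : ℝ) + 1) := by gcongr
    have h2 : Real.log ε = -lam := by rw [hlam]; ring
    rw [h2]; push_cast; linarith
  have herr : ((r : ℝ) + 1) ^ (2 * d) * ε ^ (p + 1) ≤ w0 / 2 := by
    calc _ ≤ 4 ^ d * Real.exp (lam * L / 16) * Real.exp (-(lam * L / 8)) := by gcongr
      _ = 4 ^ d * Real.exp (-(lam * L / 16)) := by
          rw [mul_assoc, ← Real.exp_add]; congr 2; ring
      _ ≤ 4 ^ d * Real.exp (Real.log (w0 / 2 / 4 ^ d)) := by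
          gcongr
          have := neg_abs_le (Real.log (w0 / 2 / 4 ^ d))
          linarith
      _ = w0 / 2 := by rw [Real.exp_log (by positivity)]; field_simp
  refine (reach_step hq.le hq1' hw0pos.le hw01 ?_ x m).trans
    (fin_bound hd hε0 hε1 hw0pos.le le_rfl m)
  intro i hi pos j S hS y
  have hcard : (E.erase i).card = s + k := by
    rw [Finset.card_erase_of_mem hi, hE]; omega
  have hne : (E.erase i).Nonempty := by
    rw [← Finset.card_pos, hcard]; omega
  have hthin : thin (E.erase i) S r := (thin_sl hV i pos j).subset hS
  have := mean_card hq.le hq1' (k := k) hne hthin hp1 hεpos hε2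
    (fun V' hV' x' m' => hH q hq hqq0 _ hrad _ hcard V' hV' x' m') y
  linarith

lemma HH_all (hd : 1 ≤ d) (s k : ℕ) (hk : 2 ≤ k) : HH d s k := by
  induction k, hk using Nat.le_induction with
  | base => exact HH_base hd s
  | succ k hk ih => exact HH_step hd s k hk ih

end Induction

/-! ### The event `B` and the final estimate -/

section Final

/-- The box `[-ℓ,ℓ]^d` as a finset. -/
def boxF (d ℓ : ℕ) : Finset (Site d) := Fintype.piFinset (fun _ => Finset.Icc (-(ℓ : ℤ)) ℓ)

lemma mem_boxF {ℓ : ℕ} {x : Site d} : x ∈ boxF d ℓ ↔ x ∈ bigBox d ℓ := by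
  simp only [boxF, bigBox, Fintype.mem_piFinset, Finset.mem_Icc, Set.mem_ofPred_eq, abs_le]

lemma thin_boxF (ℓ : ℕ) : thin Finset.univ (boxF d ℓ) (2 * ℓ) := by
  intro x hx y hy
  rw [mem_boxF] at hx hy
  refine ⟨fun i hi => absurd (Finset.mem_univ i) hi, fun i => ?_⟩
  have h1 := abs_le.1 (hx i)
  have h2 := abs_le.1 (hy i)
  rw [abs_le]
  push_cast
  constructor <;> omega

lemma adj_neighbors {u v : Site d} (h : adj u v) : v ∈ neighbors u := by
  unfold adj at h
  have hne : ∃ i, u i - v i ≠ 0 := by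
    by_contra hcon
    push Not at hcon
    simp [hcon] at h
  obtain ⟨i, hi⟩ := hne
  rw [← Finset.add_sum_erase _ _ (Finset.mem_univ i)] at h
  have h1 : 1 ≤ |u i - v i| := Int.one_le_abs hi
  have h2 : ∀ j ∈ Finset.univ.erase i, 0 ≤ |u j - v j| := fun j _ => abs_nonneg _
  have h3 := Finset.sum_nonneg h2
  have h4 : ∑ j ∈ Finset.univ.erase i, |u j - v j| = 0 := by omega
  have h5 : |u i - v i| = 1 := by omega
  have h6 := (Finset.sum_eq_zero_iff_of_nonneg h2).1 h4
  rw [mem_neighbors]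
  have key : ∀ s : Bool, v i = u i + (if s then 1 else -1) →
      v = Function.update u i (u i + if s then 1 else -1) := by
    intro s hs
    funext j
    by_cases hj : j = i
    · subst hj; simp [hs]
    · rw [Function.update_of_ne hj]
      have := h6 j (Finset.mem_erase.2 ⟨hj, Finset.mem_univ j⟩)
      rw [abs_eq_zero] at this
      omega
  rcases (abs_eq (by norm_num : (0 : ℤ) ≤ 1)).1 h5 with h | h
  · exact ⟨i, false, key false (by simp; omega)⟩
  · exact ⟨i, true, key true (by simp; omega)⟩

lemma BP_cl {k ℓ : ℕ} (η : Config d) (t : ℕ) : ∀ x ∈ bigBox d ℓ,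
    (BPstep k ℓ)^[t] (fillOutside (bigBox d ℓ) η) x = false →
      x ∈ cl k (boxF d ℓ) ((boxF d ℓ).filter (fun z => η z = false)) := by
  induction t with
  | zero =>
    intro x hx h
    simp only [Function.iterate_zero, id_eq, fillOutside, hx, if_true] at h
    apply (cl_stab k _ _).1
    rw [← mem_boxF] at hx
    simp [hx, h]
  | succ t ih =>
    intro x hx h
    rw [Function.iterate_succ_apply'] at h
    set ξ := (BPstep k ℓ)^[t] (fillOutside (bigBox d ℓ) η) with hξ
    simp only [BPstep, hx, if_true] at h
    by_cases hx1 : ξ x = true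
    · apply (cl_stab k _ _).2 x (mem_boxF.2 hx)
      have hk : k ≤ ((neighbors x).filter fun z => z ∈ bigBox d ℓ ∧ ξ z = false).card := by
        by_contra hcon
        rw [if_pos ⟨hx1, by omega⟩] at h
        exact absurd h (by simp)
      refine hk.trans (Finset.card_le_card ?_)
      intro z hz
      obtain ⟨h1, h2, h3⟩ := Finset.mem_filter.1 hz
      exact Finset.mem_inter.2 ⟨h1, ih z h2 h3⟩
    · exact ih x hx (by simpa using hx1)

lemma BPinf_cl {k ℓ : ℕ} {η : Config d} {x : Site d} (hx : x ∈ bigBox d ℓ)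
    (h : BPinf k ℓ (fillOutside (bigBox d ℓ) η) x = false) :
    x ∈ cl k (boxF d ℓ) ((boxF d ℓ).filter (fun z => η z = false)) := by
  unfold BPinf at h
  split_ifs at h with h1
  push Not at h1
  obtain ⟨t, ht⟩ := h1
  exact BP_cl η t x hx (by simpa using ht)

lemma Bevent_reach {k ℓ : ℕ} (hℓ : 2 ≤ ℓ) {η : Config d}
    (h : Bevent k ℓ (fillOutside (bigBox d ℓ) η)) :
    ∃ x ∈ neighbors (origin : Site d), reach k Finset.univ (boxF d ℓ)
      ((boxF d ℓ).filter (fun z => η z = false)) x (ℓ - 2) := by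
  obtain ⟨y, hy, i, hi⟩ := h
  unfold bpCluster at hy
  rw [Set.mem_ofPred_eq] at hy
  rcases Relation.ReflTransGen.cases_head hy with h0 | ⟨x, hx, hxy⟩
  · subst h0
    simp only [origin, abs_zero] at hi
    omega
  · have hx0 := adj_neighbors hx.1
    refine ⟨x, hx0, y, ?_, i, Finset.mem_univ i, ?_⟩
    · unfold C
      rw [mem_comp]
      refine ⟨BPinf_cl hx.2.1 hx.2.2, ?_⟩
      exact Relation.ReflTransGen.mono
        (fun a b hab => ⟨adj_neighbors hab.1, BPinf_cl hab.2.1 hab.2.2⟩) _ _ hxy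
    · have h1 := neighbors_dist hx0 i
      simp only [origin, sub_zero] at h1
      have h2 : |y i| ≤ |y i - x i| + |x i| := by
        have := abs_add_le (y i - x i) (x i)
        simpa using this
      omega

lemma measure_le_EE {q : ℝ} (h0 : 0 ≤ q) (h1 : q ≤ 1) {μ : Measure (Config d)}
    (hμ : IsBernoulliProduct q μ) (V : Finset (Site d)) (P : Finset (Site d) → Prop) :
    μ {η | P (V.filter (fun z => η z = false))} ≤ ENNReal.ofReal (EE q V (fun A => ind (P A))) := by
  have hsub : {η : Config d | P (V.filter (fun z => η z = false))} ⊆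
      ⋃ A ∈ V.powerset.filter P, {η : Config d | ∀ x ∈ V, η x = decide (x ∉ A)} := by
    intro η hη
    simp only [Set.mem_iUnion]
    refine ⟨V.filter (fun z => η z = false), Finset.mem_filter.2
      ⟨Finset.mem_powerset.2 (Finset.filter_subset _ _), hη⟩, ?_⟩
    intro x hx
    cases hb : η x <;> simp [hx, hb]
  refine (measure_mono hsub).trans ((measure_biUnion_finset_le _ _).trans ?_)
  unfold EE
  rw [ENNReal.ofReal_sum_of_nonneg]
  · rw [Finset.sum_filter]
    apply Finset.sum_le_sum
    intro A hA
    have hAV := Finset.mem_powerset.1 hA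
    beta_reduce
    by_cases hP : P A
    · rw [if_pos hP, hμ.2 V (fun x => decide (x ∉ A)), ind_true hP, mul_one,
        ← ENNReal.ofReal_prod_of_nonneg]
      · apply ENNReal.ofReal_le_ofReal
        rw [← Finset.prod_sdiff hAV, mul_comm]
        apply le_of_eq
        congr 1
        · rw [Finset.prod_congr rfl (g := fun _ => q) (fun x hx => by simp [hx]),
            Finset.prod_const]
        · rw [Finset.prod_congr rfl (g := fun _ => 1 - q)
            (fun x hx => by simp [(Finset.mem_sdiff.1 hx).2]), Finset.prod_const]
      · intro x _
        split_ifs <;> linarith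
    · rw [if_neg hP]; simp
  · intro A _
    have : 0 ≤ 1 - q := by linarith
    have := ind_nonneg (P A)
    positivity

lemma card_neighbors_le (x : Site d) : (neighbors x).card ≤ 2 * d := by
  unfold neighbors
  refine Finset.card_image_le.trans ?_
  simp [mul_comm]

lemma main_bound {k ℓ : ℕ} {q ε : ℝ} (h0 : 0 ≤ q) (h1 : q ≤ 1) (hε : 0 ≤ ε) (hℓ : 2 ≤ ℓ)
    {μ : Measure (Config d)} (hμ : IsBernoulliProduct q μ)
    (h : ∀ x m, EE q (boxF d ℓ) (fun A => ind (reach k Finset.univ (boxF d ℓ) A x m))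
      ≤ ε ^ (m + 1)) :
    μ {η | Bevent k ℓ (fillOutside (bigBox d ℓ) η)} ≤
      ENNReal.ofReal (2 * d * ε ^ (ℓ - 1)) := by
  have hsub : {η : Config d | Bevent k ℓ (fillOutside (bigBox d ℓ) η)} ⊆
      ⋃ x ∈ neighbors (origin : Site d), {η : Config d | reach k Finset.univ (boxF d ℓ)
        ((boxF d ℓ).filter (fun z => η z = false)) x (ℓ - 2)} := by
    intro η hη
    obtain ⟨x, hx, hr⟩ := Bevent_reach hℓ hη
    simp only [Set.mem_iUnion]
    exact ⟨x, hx, hr⟩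
  refine (measure_mono hsub).trans ((measure_biUnion_finset_le _ _).trans ?_)
  have hb : ∀ x ∈ neighbors (origin : Site d), μ {η : Config d | reach k Finset.univ (boxF d ℓ)
        ((boxF d ℓ).filter (fun z => η z = false)) x (ℓ - 2)} ≤ ENNReal.ofReal (ε ^ (ℓ - 1)) := by
    intro x _
    refine (measure_le_EE h0 h1 hμ (boxF d ℓ)
      (fun A => reach k Finset.univ (boxF d ℓ) A x (ℓ - 2))).trans ?_
    apply ENNReal.ofReal_le_ofReal
    have := h x (ℓ - 2)
    rwa [show ℓ - 2 + 1 = ℓ - 1 by omega] at this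
  refine (Finset.sum_le_sum hb).trans ?_
  rw [Finset.sum_const, nsmul_eq_mul, ENNReal.ofReal_mul (by positivity)]
  gcongr
  rw [show ((2 : ℝ) * d) = ((2 * d : ℕ) : ℝ) by push_cast; ring, ENNReal.ofReal_natCast]
  exact_mod_cast card_neighbors_le _

lemma scale_main (d k : ℕ) (hd : 2 ≤ d) (hk : 2 ≤ k) (hkd : k ≤ d) :
    ∃ c q₀ : ℝ, 0 < c ∧ 0 < q₀ ∧ q₀ < 1 ∧ ∀ q : ℝ, 0 < q → q < q₀ →
      ∀ μ : Measure (Config d), IsBernoulliProduct q μ → ∀ ℓ : ℕ,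
        ℓ = ⌈expIter (k - 2) (c * q ^ (-(1 : ℝ) / ((d : ℝ) - (k : ℝ) + 1)))⌉₊ →
        μ {η | Bevent k ℓ (fillOutside (bigBox d ℓ) η)} ≤
          ENNReal.ofReal (Real.exp (-1 * (ℓ : ℝ))) := by
  have hd' : (2 : ℝ) ≤ d := by exact_mod_cast hd
  set ε : ℝ := Real.exp (-2) / (2 * d) with hε
  have hε0 : 0 < ε := by positivity
  have hε1 : ε ≤ 1 := by
    rw [hε, div_le_one (by positivity)]
    have : Real.exp (-2) ≤ 1 := Real.exp_le_one_iff.2 (by norm_num)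
    linarith
  obtain ⟨cH, qH, hcH, hqH, hqH1, H⟩ := HH_all (d := d) (by omega) (d - k) k hk ε hε0 hε1
  obtain ⟨c, T, hc, hT, hcomp⟩ := expIter_compare (k - 2) cH (1 / 4) hcH (by norm_num)
  obtain ⟨q1, hq1, hq1', ht⟩ := t_large (d - k) (max T (max (4 / cH) (2 / c)))
  refine ⟨c, min qH q1, hc, lt_min hqH hq1, lt_of_le_of_lt (min_le_left _ _) hqH1, ?_⟩
  intro q hq hqq μ hμ ℓ hℓ
  have hqH2 : q < qH := lt_of_lt_of_le hqq (min_le_left _ _)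
  have es : ((d - k : ℕ) : ℝ) + 1 = (d : ℝ) - (k : ℝ) + 1 := by rw [Nat.cast_sub hkd]
  have htq := ht q hq (lt_of_lt_of_le hqq (min_le_right _ _))
  have HH := H q hq hqH2
  rw [es] at htq HH
  set t := q ^ (-(1 : ℝ) / ((d : ℝ) - (k : ℝ) + 1)) with htdef
  have hT1 : T ≤ t := (le_max_left _ _).trans htq
  have hT2 : 4 / cH ≤ t := ((le_max_left _ _).trans (le_max_right _ _)).trans htq
  have hT3 : 2 / c ≤ t := ((le_max_right _ _).trans (le_max_right _ _)).trans htq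
  rw [div_le_iff₀ hcH] at hT2
  rw [div_le_iff₀ hc] at hT3
  have g1 := expIter_ge (k - 2) (cH * t)
  have g2 := expIter_ge (k - 2) (c * t)
  have g3 := hcomp t hT1
  have hl2 : expIter (k - 2) (c * t) ≤ ℓ := by rw [hℓ]; exact Nat.le_ceil _
  have hl3 : (ℓ : ℝ) < expIter (k - 2) (c * t) + 1 := by
    rw [hℓ]; exact Nat.ceil_lt_add_one (by linarith)
  have hl : 2 ≤ ℓ := by
    have : (2 : ℝ) ≤ ℓ := by linarith
    exact_mod_cast this
  have hr : ((2 * ℓ : ℕ) : ℝ) ≤ expIter (k - 2) (cH * t) := by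
    push_cast; linarith
  refine (main_bound hq.le (by linarith) hε0.le hl hμ
    (HH (2 * ℓ) hr Finset.univ (by simp; omega) (boxF d ℓ) (thin_boxF ℓ))).trans ?_
  apply ENNReal.ofReal_le_ofReal
  obtain ⟨n, rfl⟩ : ∃ n, ℓ = n + 2 := ⟨ℓ - 2, by omega⟩
  have e1 : n + 2 - 1 = n + 1 := by omega
  rw [e1, hε, div_pow, ← Real.exp_nat_mul]
  have hp : 2 * (d : ℝ) ≤ (2 * (d : ℝ)) ^ (n + 1) :=
    le_self_pow₀ (by linarith) (by omega)
  calc 2 * (d : ℝ) * (Real.exp (((n + 1 : ℕ) : ℝ) * -2) / (2 * (d : ℝ)) ^ (n + 1))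
      = Real.exp (((n + 1 : ℕ) : ℝ) * -2) * (2 * (d : ℝ) / (2 * (d : ℝ)) ^ (n + 1)) := by ring
    _ ≤ Real.exp (((n + 1 : ℕ) : ℝ) * -2) * 1 := by
        gcongr
        exact div_le_one_of_le₀ hp (by positivity)
    _ ≤ _ := by
        rw [mul_one]
        apply Real.exp_le_exp.2
        push_cast
        have : (0 : ℝ) ≤ n := Nat.cast_nonneg n
        linarith

end Final

/-- There are `c, γ > 0` and `q₀ ∈ (0,1)` such that for
`0 < q < q₀`, with `ℓ = ℓ(q)` as stated, `μ(B) ≤ e^{-γℓ}`. -/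
theorem statement14 (d k : ℕ) (hd : 2 ≤ d) (hk : 2 ≤ k) (hkd : k ≤ d) :
    ∃ c γ q₀ : ℝ, 0 < c ∧ 0 < γ ∧ 0 < q₀ ∧ q₀ < 1 ∧
      ∀ q : ℝ, 0 < q → q < q₀ →
        ∀ μ : Measure (Config d), IsBernoulliProduct q μ →
          μ {η | Bevent k
              (if k = 2 then ⌈c * q ^ (-(1 : ℝ) / ((d : ℝ) - 1))⌉₊
               else ⌈expIter (k - 2) (c * q ^ (-(1 : ℝ) / ((d : ℝ) - (k : ℝ) + 1)))⌉₊)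
              (fillOutside
                (bigBox d
                  (if k = 2 then ⌈c * q ^ (-(1 : ℝ) / ((d : ℝ) - 1))⌉₊
                   else ⌈expIter (k - 2) (c * q ^ (-(1 : ℝ) / ((d : ℝ) - (k : ℝ) + 1)))⌉₊))
                η)} ≤
            ENNReal.ofReal
              (Real.exp (-γ *
                (if k = 2 then ⌈c * q ^ (-(1 : ℝ) / ((d : ℝ) - 1))⌉₊
                 else ⌈expIter (k - 2) (c * q ^ (-(1 : ℝ) / ((d : ℝ) - (k : ℝ) + 1)))⌉₊ : ℕ))) := by
  obtain ⟨c, q₀, hc, hq0, hq1, h⟩ := scale_main d k hd hk hkd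
  refine ⟨c, 1, q₀, hc, one_pos, hq0, hq1, ?_⟩
  intro q hq hqq μ hμ
  refine h q hq hqq μ hμ _ ?_
  split_ifs with hk2
  · subst hk2
    have e : (d : ℝ) - ((2 : ℕ) : ℝ) + 1 = (d : ℝ) - 1 := by push_cast; ring
    rw [e]
    rfl
  · rfl

end KA
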